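/- Let f be an integral binary quartic form, irreducible over ℚ, with discriminant D, let κ be a real number with 0 < κ < 1, and set D₁ = (7/2)¹² · 4⁴. If |D| > D₁^{1/(1−κ)}, then the number of pairs (x,y) ∈ ℤ² with |f(x,y)| = 1, counted up to the identification (x,y) ∼ (−x,−y), is at most ⌊36 + 8/κ⌋. -/

import Mathlib

/-- Evaluation of the binary quartic form with coefficients `a, b, c, d, e` at `(x, y)`. -/
def quarticEval (a b c d e x y : ℤ) : ℤ :=
  a * x ^ 4 + b * x ^ 3 * y + c * x ^ 2 * y ^ 2 + d * x * y ^ 3 + e * y ^ 4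

/-- The discriminant of the integral binary quartic form `ax⁴ + bx³y + cx²y² + dxy³ + ey⁴`. -/
def quarticDisc (a b c d e : ℤ) : ℤ :=
  256 * a ^ 3 * e ^ 3 - 192 * a ^ 2 * b * d * e ^ 2 - 128 * a ^ 2 * c ^ 2 * e ^ 2
    + 144 * a ^ 2 * c * d ^ 2 * e - 27 * a ^ 2 * d ^ 4 + 144 * a * b ^ 2 * c * e ^ 2
    - 6 * a * b ^ 2 * d ^ 2 * e - 80 * a * b * c ^ 2 * d * e + 18 * a * b * c * d ^ 3
    + 16 * a * c ^ 4 * e - 4 * a * c ^ 3 * d ^ 2 - 27 * b ^ 4 * e ^ 2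
    + 18 * b ^ 3 * c * d * e - 4 * b ^ 3 * d ^ 3 - 4 * b ^ 2 * c ^ 3 * e
    + b ^ 2 * c ^ 2 * d ^ 2

open Polynomial in
/-- The dehomogenization `f(x,1)` (over `ℚ`) of the integral binary quartic form
`ax⁴ + bx³y + cx²y² + dxy³ + ey⁴`. -/
noncomputable def quarticPoly (a b c d e : ℤ) : Polynomial ℚ :=
  C (a : ℚ) * X ^ 4 + C (b : ℚ) * X ^ 3 + C (c : ℚ) * X ^ 2 + C (d : ℚ) * X + C (e : ℚ)

section

open Polynomial

theorem eval_hasseDeriv_eq_sum {R : Type*} [CommRing R] {p : R[X]} {n : ℕ} (hp : p.natDegree < n)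
    (v : ℕ) (r : R) :
    (hasseDeriv v p).eval r =
      ∑ i ∈ Finset.range n, (i.choose v : R) * p.coeff i * r ^ (i - v) := by
  rw [hasseDeriv_apply, p.sum_over_range' _ n hp, eval_finsetSum]
  · simp [eval_monomial]
  · simp

theorem aeval_hasseDeriv_eq_sum {R S : Type*} [CommRing R] [CommRing S] [Algebra R S] {p : R[X]}
    {n : ℕ} (hp : p.natDegree < n) (v : ℕ) (r : S) :
    aeval r (hasseDeriv v p) =
      ∑ i ∈ Finset.range n, (i.choose v : S) * algebraMap R S (p.coeff i) * r ^ (i - v) := by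
  rw [hasseDeriv_apply, p.sum_over_range' _ n hp, map_sum]
  · simp [aeval_monomial]
  · simp

theorem norm_eval_hasseDeriv_le {p : ℂ[X]} {n : ℕ} (hp : p.natDegree < n) {K R : ℝ}
    (hK : ∀ i, ‖p.coeff i‖ ≤ K) (hR : 1 ≤ R) (v : ℕ) {r : ℂ} (hr : ‖r‖ ≤ R) :
    ‖(hasseDeriv v p).eval r‖ ≤ n * (2 ^ n * K * R ^ n) := by
  rw [eval_hasseDeriv_eq_sum hp]
  rw [show n * (2 ^ n * K * R ^ n) = ∑ _i ∈ Finset.range n, 2 ^ n * K * R ^ n by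
    rw [Finset.sum_const, Finset.card_range, nsmul_eq_mul]]
  refine norm_sum_le_of_le _ fun i hi => ?_
  rw [Finset.mem_range] at hi
  have hK0 : 0 ≤ K := (norm_nonneg _).trans (hK 0)
  rw [norm_mul, norm_mul, norm_pow, Complex.norm_natCast]
  have h1 : (i.choose v : ℝ) ≤ 2 ^ n := by
    exact_mod_cast (Nat.choose_le_two_pow i v).trans (Nat.pow_le_pow_right two_pos hi.le)
  have h2 : ‖r‖ ^ (i - v) ≤ R ^ n :=
    (pow_le_pow_left₀ (norm_nonneg _) hr _).trans (pow_le_pow_right₀ hR (by omega))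
  have := hK i
  gcongr

theorem norm_eval_hasseDeriv_le_of_coeff_eq_zero {p : ℂ[X]} {n k : ℕ} (hp : p.natDegree < n)
    {K : ℝ} (hK : ∀ i, ‖p.coeff i‖ ≤ K) (hk : ∀ i < k, p.coeff i = 0) (v : ℕ) {r : ℂ}
    (hr : ‖r‖ ≤ 1) :
    ‖(hasseDeriv v p).eval r‖ ≤ n * (2 ^ n * K * ‖r‖ ^ (k - v)) := by
  rw [eval_hasseDeriv_eq_sum hp]
  rw [show n * (2 ^ n * K * ‖r‖ ^ (k - v)) = ∑ _i ∈ Finset.range n, 2 ^ n * K * ‖r‖ ^ (k - v) by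
    rw [Finset.sum_const, Finset.card_range, nsmul_eq_mul]]
  refine norm_sum_le_of_le _ fun i hi => ?_
  rw [Finset.mem_range] at hi
  have hK0 : 0 ≤ K := (norm_nonneg _).trans (hK 0)
  rcases lt_or_ge i k with hik | hik
  · rw [hk i hik]; simp; positivity
  rw [norm_mul, norm_mul, norm_pow, Complex.norm_natCast]
  have h1 : (i.choose v : ℝ) ≤ 2 ^ n := by
    exact_mod_cast (Nat.choose_le_two_pow i v).trans (Nat.pow_le_pow_right two_pos hi.le)
  have h2 : ‖r‖ ^ (i - v) ≤ ‖r‖ ^ (k - v) :=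
    pow_le_pow_of_le_one (norm_nonneg _) hr (by omega)
  have := hK i
  gcongr

/-- Powers of a root of a monic integral quartic in terms of `1, β, β², β³`. -/
theorem exists_pow_eq_sum_of_quartic {β : ℂ} {b c d e : ℤ} {Q : ℝ}
    (hβ : β ^ 4 + b * β ^ 3 + c * β ^ 2 + d * β + e = 0)
    (hb : 1 + |(b : ℝ)| ≤ Q) (hc : 1 + |(c : ℝ)| ≤ Q) (hd : 1 + |(d : ℝ)| ≤ Q)
    (he : 1 + |(e : ℝ)| ≤ Q) (r : ℕ) :
    ∃ w : Fin 4 → ℤ, β ^ r = ∑ j, (w j : ℂ) * β ^ (j : ℕ) ∧ ∀ j, |(w j : ℝ)| ≤ Q ^ r := by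
  have hQ : 0 ≤ Q := by linarith [abs_nonneg (b : ℝ)]
  induction r with
  | zero =>
    refine ⟨![1, 0, 0, 0], by simp [Fin.sum_univ_four], fun j => ?_⟩
    fin_cases j <;> simp
  | succ r ih =>
    obtain ⟨w, hw, hwQ⟩ := ih
    have key (m : ℤ) (hm : 1 + |(m : ℝ)| ≤ Q) (i : Fin 4) :
        |(w i : ℝ) - w 3 * m| ≤ Q ^ (r + 1) := by
      have h3 := hwQ 3
      calc |(w i : ℝ) - w 3 * m| ≤ |(w i : ℝ)| + |(w 3 : ℝ)| * |(m : ℝ)| := by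
            rw [← abs_mul]; exact abs_sub _ _
        _ ≤ Q ^ r + Q ^ r * |(m : ℝ)| := by
            gcongr; exact hwQ i
        _ = Q ^ r * (1 + |(m : ℝ)|) := by ring
        _ ≤ Q ^ r * Q := by gcongr
        _ = _ := (pow_succ _ _).symm
    refine ⟨![- w 3 * e, w 0 - w 3 * d, w 1 - w 3 * c, w 2 - w 3 * b], ?_, fun j => ?_⟩
    · rw [pow_succ, hw]
      simp only [Fin.sum_univ_four, Fin.isValue, Fin.coe_ofNat_eq_mod, Matrix.cons_val]
      push_cast
      linear_combination (w 3 : ℂ) * hβ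
    · fin_cases j
      · have h3 := hwQ 3
        simp only [Fin.zero_eta, Fin.isValue, Matrix.cons_val_zero]
        push_cast
        rw [abs_mul, abs_neg, pow_succ]
        gcongr
        linarith
      · simpa using key d hd 0
      · simpa using key c hc 1
      · simpa using key b hb 2

attribute [local instance] Matrix.seminormedAddCommGroup in
theorem exists_auxiliary_polynomials {β : ℂ} {b c d e : ℤ} {Q : ℝ}
    (hβ : β ^ 4 + b * β ^ 3 + c * β ^ 2 + d * β + e = 0)
    (hb : 1 + |(b : ℝ)| ≤ Q) (hc : 1 + |(c : ℝ)| ≤ Q) (hd : 1 + |(d : ℝ)| ≤ Q)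
    (he : 1 + |(e : ℝ)| ≤ Q) {k m n : ℕ} (hk : 0 < k) (hm : 0 < m) (hkm : k ≤ 3 * m)
    (hn : n = 2 * k + m) :
    ∃ A B : ℤ[X], (A ≠ 0 ∨ B ≠ 0) ∧ A.natDegree < n ∧ B.natDegree < n ∧
      (∀ i, |(A.coeff i : ℝ)| ≤ (4 * Q) ^ (6 * n)) ∧ (∀ i, |(B.coeff i : ℝ)| ≤ (4 * Q) ^ (6 * n)) ∧
      ∀ l < k, aeval β (hasseDeriv l A) = β * aeval β (hasseDeriv l B) := by
  have hQ : 1 ≤ Q := by linarith [abs_nonneg (b : ℝ)]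
  choose w hw hwQ using exists_pow_eq_sum_of_quartic hβ hb hc hd he
  let M : Matrix (Fin k × Fin 4) (Fin n ⊕ Fin n) ℤ := fun r s => Sum.elim
    (fun i : Fin n => ((i : ℕ).choose r.1 : ℤ) * w (i - r.1) r.2)
    (fun i : Fin n => -(((i : ℕ).choose r.1 : ℤ) * w (i - r.1 + 1) r.2)) s
  have hM : ‖M‖ ≤ 2 ^ (n - 1) * Q ^ n := by
    have key (i : Fin n) (l s : ℕ) (hs : s ≤ n) (j : Fin 4) :
        |(((i : ℕ).choose l * w s j : ℤ) : ℝ)| ≤ 2 ^ (n - 1) * Q ^ n := by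
      push_cast
      rw [abs_mul, Nat.abs_cast]
      have h1 : ((i : ℕ).choose l : ℝ) ≤ 2 ^ (n - 1) := by
        exact_mod_cast (Nat.choose_le_two_pow _ _).trans (Nat.pow_le_pow_right two_pos (by omega))
      have h2 := (hwQ s j).trans (pow_le_pow_right₀ hQ hs)
      gcongr
    refine (Matrix.norm_le_iff (by positivity)).2 fun r s => ?_
    rw [Int.norm_eq_abs]
    rcases s with i | i
    · exact key i _ _ (by omega) _
    · simp only [M, Sum.elim_inr, Int.cast_neg, abs_neg]
      exact key i _ _ (by omega) _
  obtain ⟨t, ht0, ht, htS⟩ := Int.Matrix.exists_ne_zero_int_vec_norm_le M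
    (by simp only [Fintype.card_prod, Fintype.card_fin, Fintype.card_sum]; omega)
    (by simp only [Fintype.card_prod, Fintype.card_fin]; omega)
  have hS : ‖t‖ ≤ (4 * Q) ^ (6 * n) := by
    refine htS.trans ?_
    simp only [Fintype.card_prod, Fintype.card_fin, Fintype.card_sum]
    have h1 : (1 : ℝ) ≤ ((n + n : ℕ) : ℝ) * max 1 ‖M‖ := by
      have : (1 : ℝ) ≤ ((n + n : ℕ) : ℝ) := by exact_mod_cast (by omega)
      nlinarith [le_max_left 1 ‖M‖]
    have h2 : ((n + n : ℕ) : ℝ) * max 1 ‖M‖ ≤ (4 * Q) ^ n := by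
      have h3 : max 1 ‖M‖ ≤ 2 ^ (n - 1) * Q ^ n :=
        max_le (one_le_mul_of_one_le_of_one_le (one_le_pow₀ one_le_two) (one_le_pow₀ hQ)) hM
      have h4 : (n : ℝ) ≤ 2 ^ n := by exact_mod_cast n.lt_two_pow_self.le
      have h5 : (2 : ℝ) ^ n = 2 * 2 ^ (n - 1) := by
        rw [← pow_succ']; congr 1; omega
      calc ((n + n : ℕ) : ℝ) * max 1 ‖M‖ ≤ ((n + n : ℕ) : ℝ) * (2 ^ (n - 1) * Q ^ n) := by gcongr
        _ = n * 2 ^ n * Q ^ n := by rw [h5]; push_cast; ring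
        _ ≤ 2 ^ n * 2 ^ n * Q ^ n := by gcongr
        _ = (4 * Q) ^ n := by rw [← mul_pow, ← mul_pow]; norm_num
    have h6 : (((k * 4 : ℕ) : ℝ) / (((n + n : ℕ) : ℝ) - ((k * 4 : ℕ) : ℝ))) ≤ (6 : ℕ) := by
      have hkm' : (k : ℝ) ≤ 3 * m := by exact_mod_cast hkm
      have hm' : (0 : ℝ) < m := by exact_mod_cast hm
      subst hn
      push_cast
      rw [div_le_iff₀ (by linarith)]
      linarith
    calc _ ≤ (((n + n : ℕ) : ℝ) * max 1 ‖M‖) ^ ((6 : ℕ) : ℝ) :=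
          Real.rpow_le_rpow_of_exponent_le h1 h6
      _ ≤ ((4 * Q) ^ n) ^ 6 := by rw [Real.rpow_natCast]; gcongr
      _ = _ := by rw [← pow_mul, mul_comm n]
  have hA : ∀ i : Fin n, (ofFn n fun i => t (.inl i)).coeff i = t (.inl i) := fun i => by
    rw [ofFn_coeff_eq_val_of_lt _ i.2]
  have hB : ∀ i : Fin n, (ofFn n fun i => t (.inr i)).coeff i = t (.inr i) := fun i => by
    rw [ofFn_coeff_eq_val_of_lt _ i.2]
  have htS' (s) : |(t s : ℝ)| ≤ (4 * Q) ^ (6 * n) := by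
    rw [← Int.norm_eq_abs]; exact (norm_le_pi_norm t s).trans hS
  refine ⟨ofFn n fun i => t (.inl i), ofFn n fun i => t (.inr i), ?_,
    ofFn_natDegree_lt (by omega) _, ofFn_natDegree_lt (by omega) _, fun i => ?_, fun i => ?_,
    fun l hl => ?_⟩
  · by_contra! h
    refine ht0 (funext fun s => ?_)
    rcases s with i | i
    · rw [← hA i, h.1]; simp
    · rw [← hB i, h.2]; simp
  · rcases lt_or_ge i n with hi | hi
    · rw [ofFn_coeff_eq_val_of_lt _ hi]; exact htS' _
    · rw [ofFn_coeff_eq_zero_of_ge _ hi]; simp; positivity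
  · rcases lt_or_ge i n with hi | hi
    · rw [ofFn_coeff_eq_val_of_lt _ hi]; exact htS' _
    · rw [ofFn_coeff_eq_zero_of_ge _ hi]; simp; positivity
  · rw [aeval_hasseDeriv_eq_sum (ofFn_natDegree_lt (by omega) _),
      aeval_hasseDeriv_eq_sum (ofFn_natDegree_lt (by omega) _), Finset.sum_range, Finset.sum_range]
    simp only [hA, hB]
    have hrow (j : Fin 4) : ∑ i : Fin n, ((i : ℕ).choose l : ℂ) * t (.inl i) * w (i - l) j =
        ∑ i : Fin n, ((i : ℕ).choose l : ℂ) * t (.inr i) * w (i - l + 1) j := by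
      have := congrFun ht (⟨l, hl⟩, j)
      simp only [Matrix.mulVec, dotProduct, Fintype.sum_sum_type, M, Sum.elim_inl, Sum.elim_inr,
        Pi.zero_apply] at this
      have h := congrArg (Int.cast : ℤ → ℂ) this
      push_cast at h
      rw [← sub_eq_zero, ← h, sub_eq_add_neg, ← Finset.sum_neg_distrib]
      congr 1 <;> refine Finset.sum_congr rfl fun i _ => by ring
    calc _ = ∑ j : Fin 4, (∑ i : Fin n, ((i : ℕ).choose l : ℂ) * t (.inl i) * w (i - l) j) *
          β ^ (j : ℕ) := by
          simp_rw [Finset.sum_mul]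
          rw [Finset.sum_comm]
          refine Finset.sum_congr rfl fun i _ => ?_
          rw [hw (i - l), Finset.mul_sum]
          refine Finset.sum_congr rfl fun j _ => ?_
          rw [eq_intCast]; ring
      _ = _ := by
          simp_rw [hrow, Finset.sum_mul, Finset.mul_sum]
          rw [Finset.sum_comm]
          refine Finset.sum_congr rfl fun i _ => ?_
          rw [show ∀ x y : ℂ, β * (x * y * β ^ ((i : ℕ) - l)) = x * y * β ^ ((i : ℕ) - l + 1) by
            intros; ring, hw (i - l + 1), Finset.mul_sum]
          refine Finset.sum_congr rfl fun j _ => ?_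
          rw [eq_intCast]; ring

theorem minpoly_pow_dvd_of_X_sub_C_pow_dvd {β : ℂ} (hβ : IsIntegral ℚ β) {G : ℚ[X]} {k : ℕ}
    (h : (X - C β) ^ k ∣ G.map (algebraMap ℚ ℂ)) : minpoly ℚ β ^ k ∣ G := by
  induction k generalizing G with
  | zero => simp
  | succ k ih =>
    obtain ⟨p, hp⟩ := minpoly.dvd ℚ β (p := G) <| by
      obtain ⟨u, hu⟩ := h
      rw [← eval_map_algebraMap, hu]; simp
    obtain ⟨s, hs⟩ : X - C β ∣ (minpoly ℚ β).map (algebraMap ℚ ℂ) := by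
      rw [dvd_iff_isRoot, IsRoot, eval_map_algebraMap, minpoly.aeval]
    have hs0 : s.eval β ≠ 0 := fun h0 => by
      have hsep := (minpoly.irreducible hβ).separable.aeval_derivative_ne_zero (minpoly.aeval ℚ β)
      refine hsep ?_
      rw [← eval_map_algebraMap, ← derivative_map, hs]
      simp [h0]
    have hcop : IsCoprime ((X - C β) ^ k) s := by
      refine IsCoprime.pow_left ((irreducible_X_sub_C β).coprime_iff_not_dvd.2 fun hd => hs0 ?_)
      exact dvd_iff_isRoot.1 hd
    have hX : (X - C β : ℂ[X]) ≠ 0 := X_sub_C_ne_zero β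
    rw [hp, Polynomial.map_mul, hs, pow_succ', mul_assoc] at h
    rw [hp, pow_succ']
    exact mul_dvd_mul_left _ (ih (hcop.dvd_of_dvd_mul_left ((mul_dvd_mul_iff_left hX).1 h)))

theorem wronskian_ne_zero_of_X_sub_C_pow_dvd {β : ℂ} (hβ : IsIntegral ℚ β)
    (hβ1 : 1 < (minpoly ℚ β).natDegree) {A B : ℚ[X]} {k : ℕ} (h0 : A ≠ 0 ∨ B ≠ 0)
    (hA : A.natDegree < (minpoly ℚ β).natDegree * k)
    (hB : B.natDegree < (minpoly ℚ β).natDegree * k)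
    (h : (X - C β) ^ k ∣ A.map (algebraMap ℚ ℂ) - C β * B.map (algebraMap ℚ ℂ)) :
    wronskian A B ≠ 0 := by
  intro hW
  have hG0 : gcd A B ≠ 0 := fun hg => by
    rw [gcd_eq_zero_iff] at hg; tauto
  obtain ⟨a', b', ha, hb, hab⟩ := extract_gcd A B
  generalize gcd A B = G at hG0 ha hb
  rw [gcd_isUnit_iff] at hab
  have hW' : wronskian a' b' = 0 := by
    have h1 : wronskian A B = G ^ 2 * wronskian a' b' := by
      rw [ha, hb, wronskian, wronskian, derivative_mul, derivative_mul]; ring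
    rw [h1] at hW
    exact (mul_eq_zero.1 hW).resolve_left (pow_ne_zero 2 hG0)
  obtain ⟨hda, hdb⟩ := hab.wronskian_eq_zero_iff.1 hW'
  obtain ⟨u, hu⟩ := natDegree_eq_zero.1 (derivative_eq_zero.1 hda)
  obtain ⟨v, hv⟩ := natDegree_eq_zero.1 (derivative_eq_zero.1 hdb)
  subst hu hv
  have hβQ : β ∉ (algebraMap ℚ ℂ).range := fun hmem => by
    rw [← minpoly.natDegree_eq_one_iff] at hmem; omega
  have huv : (u : ℂ) - β * v ≠ 0 := fun h1 => by
    by_cases hv : v = 0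
    · have hu : u = 0 := by simpa [hv] using h1
      simp [ha, hb, hu, hv] at h0
    · refine hβQ ⟨u / v, ?_⟩
      have : (v : ℂ) ≠ 0 := by exact_mod_cast hv
      simp only [eq_ratCast, Rat.cast_div]
      field_simp
      linear_combination h1
  have hE : A.map (algebraMap ℚ ℂ) - C β * B.map (algebraMap ℚ ℂ) =
      G.map (algebraMap ℚ ℂ) * C ((u : ℂ) - β * v) := by
    rw [ha, hb]; simp only [Polynomial.map_mul, map_C, eq_ratCast, C_sub, C_mul]; ring
  rw [hE, (isUnit_C.2 (IsUnit.mk0 _ huv)).dvd_mul_right] at h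
  have hdvd := minpoly_pow_dvd_of_X_sub_C_pow_dvd hβ h
  have hdeg : (minpoly ℚ β).natDegree * k = (minpoly ℚ β ^ k).natDegree := by
    rw [natDegree_pow, mul_comm]
  rw [hdeg] at hA hB
  rcases h0 with h0 | h0
  · exact absurd (natDegree_le_of_dvd (hdvd.trans (ha ▸ dvd_mul_right _ _)) h0) hA.not_ge
  · exact absurd (natDegree_le_of_dvd (hdvd.trans (hb ▸ dvd_mul_right _ _)) h0) hB.not_ge

theorem isPrimitive_C_mul_X_sub_C {p q : ℤ} (h : IsCoprime p q) :
    (C q * X - C p : ℤ[X]).IsPrimitive := by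
  intro r hr
  rw [C_dvd_iff_dvd_coeff] at hr
  have h1 : r ∣ q := by simpa [-eq_intCast, -map_intCast, coeff_C] using hr 1
  have h0 : r ∣ p := by simpa [coeff_C] using hr 0
  exact h.isUnit_of_dvd' h0 h1

theorem abs_coeff_wronskian_le {A B : ℤ[X]} {n : ℕ} {S : ℝ} (hA : A.natDegree < n)
    (hB : B.natDegree < n) (hAS : ∀ i, |(A.coeff i : ℝ)| ≤ S) (hBS : ∀ i, |(B.coeff i : ℝ)| ≤ S)
    (hW : wronskian A B ≠ 0) (N : ℕ) : |((wronskian A B).coeff N : ℝ)| ≤ (2 * n * S) ^ 2 := by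
  have hS : 0 ≤ S := (abs_nonneg _).trans (hAS 0)
  have hder {p : ℤ[X]} (hp : p.natDegree < n) (hpS : ∀ i, |(p.coeff i : ℝ)| ≤ S) (i : ℕ) :
      |((derivative p).coeff i : ℝ)| ≤ n * S := by
    rw [coeff_derivative]
    rcases lt_or_ge (i + 1) n with hi | hi
    · have : ((i : ℝ) + 1) ≤ n := by exact_mod_cast hi.le
      push_cast
      rw [abs_mul, mul_comm, abs_of_nonneg (by positivity : (0 : ℝ) ≤ i + 1)]
      gcongr
      exact hpS _
    · rw [coeff_eq_zero_of_natDegree_lt (by omega)]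
      simp; positivity
  have hmul {p q : ℤ[X]} {s t : ℝ} (hp : ∀ i, |(p.coeff i : ℝ)| ≤ s)
      (hq : ∀ i, |(q.coeff i : ℝ)| ≤ t) (i : ℕ) :
      |((p * q).coeff i : ℝ)| ≤ (i + 1) * (s * t) := by
    rw [coeff_mul]
    push_cast
    refine (Finset.abs_sum_le_sum_abs _ _).trans ((Finset.sum_le_card_nsmul _ _ (s * t) ?_).trans ?_)
    · intro x _
      rw [abs_mul]
      have := (abs_nonneg _).trans (hp 0)
      gcongr
      exacts [hp _, hq _]
    · simp
  rcases lt_or_ge (2 * n) (N + 1) with hN | hN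
  · have := natDegree_wronskian_lt_add hW
    rw [coeff_eq_zero_of_natDegree_lt (by omega)]
    simp; positivity
  · have hN' : ((N : ℝ) + 1) ≤ 2 * n := by exact_mod_cast hN
    rw [wronskian, coeff_sub]
    push_cast
    calc _ ≤ (N + 1) * (S * (n * S)) + (N + 1) * ((n * S) * S) :=
          (abs_sub _ _).trans (add_le_add (hmul hAS (hder hB hBS) N) (hmul (hder hA hAS) hBS N))
      _ ≤ 2 * n * (S * (n * S)) + 2 * n * ((n * S) * S) := by gcongr
      _ = _ := by ring

theorem pow_rootMultiplicity_sub_one_le {A B : ℤ[X]} {n : ℕ} {S : ℝ} (hA : A.natDegree < n)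
    (hB : B.natDegree < n) (hAS : ∀ i, |(A.coeff i : ℝ)| ≤ S) (hBS : ∀ i, |(B.coeff i : ℝ)| ≤ S)
    (hW : wronskian A B ≠ 0) {p₁ q₁ p₂ q₂ : ℤ} (hq₁ : 0 < q₁) (hpq : IsCoprime p₁ q₁)
    (hq₂ : q₂ ≠ 0) :
    (q₁ : ℝ) ^ (((C q₂ * A - C p₂ * B).map (Int.castRingHom ℚ)).rootMultiplicity
      (p₁ / q₁ : ℚ) - 1) ≤ (2 * n * S) ^ 2 := by
  set f : ℤ[X] := C q₂ * A - C p₂ * B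
  set v := (f.map (Int.castRingHom ℚ)).rootMultiplicity (p₁ / q₁ : ℚ)
  have hq₁' : (q₁ : ℚ) ≠ 0 := by exact_mod_cast hq₁.ne'
  have hq₂' : (q₂ : ℚ) ≠ 0 := by exact_mod_cast hq₂
  have hf : (X - C (p₁ / q₁ : ℚ)) ^ v ∣ f.map (Int.castRingHom ℚ) := pow_rootMultiplicity_dvd _ _
  have hWf : C (q₂ : ℚ) * (wronskian A B).map (Int.castRingHom ℚ) =
      wronskian (f.map (Int.castRingHom ℚ)) (B.map (Int.castRingHom ℚ)) := by
    have hint (z : ℤ) : (C z : ℤ[X]).map (Int.castRingHom ℚ) = C (z : ℚ) := by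
      rw [map_C]; rfl
    simp only [wronskian, f, Polynomial.map_sub, Polynomial.map_mul, ← derivative_map, hint,
      derivative_sub, derivative_mul, derivative_C]
    ring
  have h1 : (X - C (p₁ / q₁ : ℚ)) ^ (v - 1) ∣ (wronskian A B).map (Int.castRingHom ℚ) := by
    rw [← (isUnit_C.2 (IsUnit.mk0 _ hq₂')).dvd_mul_left, hWf, wronskian]
    exact dvd_sub (((pow_dvd_pow _ (Nat.sub_le _ _)).trans hf).mul_right _)
      ((pow_sub_one_dvd_derivative_of_pow_dvd hf).mul_right _)
  have h2 : (C q₁ * X - C p₁ : ℤ[X]) ^ (v - 1) ∣ wronskian A B := by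
    have hprim : ((C q₁ * X - C p₁ : ℤ[X]) ^ (v - 1)).IsPrimitive := by
      generalize v - 1 = j
      induction j with
      | zero => simp [isPrimitive_one]
      | succ j ih => rw [pow_succ]; exact ih.mul (isPrimitive_C_mul_X_sub_C hpq)
    rw [IsPrimitive.Int.dvd_iff_map_cast_dvd_map_cast _ _ hprim]
    have hlin : (C q₁ * X - C p₁ : ℤ[X]).map (Int.castRingHom ℚ) =
        C (q₁ : ℚ) * (X - C (p₁ / q₁ : ℚ)) := by
      rw [mul_sub, ← C_mul, mul_div_cancel₀ _ hq₁', Polynomial.map_sub, Polynomial.map_mul, map_X,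
        map_C, map_C]
      rfl
    rw [Polynomial.map_pow, hlin, mul_pow, ← C_pow,
      (isUnit_C.2 (IsUnit.mk0 _ (pow_ne_zero _ hq₁'))).mul_left_dvd]
    exact h1
  obtain ⟨t, ht⟩ := h2
  have hlead : (wronskian A B).leadingCoeff = q₁ ^ (v - 1) * t.leadingCoeff := by
    rw [ht, leadingCoeff_mul, leadingCoeff_pow]
    congr 2
    rw [sub_eq_add_neg, ← C_neg, leadingCoeff_linear hq₁.ne']
  have hdvd : q₁ ^ (v - 1) ≤ |(wronskian A B).leadingCoeff| := by
    refine Int.le_of_dvd (abs_pos.2 (leadingCoeff_ne_zero.2 hW)) ((dvd_abs _ _).2 ⟨_, hlead⟩)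
  calc (q₁ : ℝ) ^ (v - 1) ≤ |((wronskian A B).leadingCoeff : ℝ)| := by exact_mod_cast hdvd
    _ ≤ _ := abs_coeff_wronskian_le hA hB hAS hBS hW _

theorem map_hasseDeriv {R S : Type*} [Semiring R] [Semiring S] (g : R →+* S) (v : ℕ) (p : R[X]) :
    (hasseDeriv v p).map g = hasseDeriv v (p.map g) := by
  ext i
  simp [hasseDeriv_coeff]

theorem one_le_of_eval_hasseDeriv_ne_zero {β : ℂ} {A B : ℤ[X]} {k n v : ℕ} {Q S : ℝ}
    (hA : A.natDegree < n) (hB : B.natDegree < n) (hAS : ∀ i, |(A.coeff i : ℝ)| ≤ S)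
    (hBS : ∀ i, |(B.coeff i : ℝ)| ≤ S)
    (hvan : ∀ l < k, aeval β (hasseDeriv l A) = β * aeval β (hasseDeriv l B))
    (hβ : 1 + ‖β‖ ≤ Q) {p₁ q₁ p₂ q₂ : ℤ} (hq₁ : 0 < q₁) (hq₂ : 0 < q₂)
    (hr₁ : ‖β - p₁ / q₁‖ ≤ 1)
    (hne : (hasseDeriv v ((C q₂ * A - C p₂ * B).map (Int.castRingHom ℚ))).eval (p₁ / q₁ : ℚ) ≠ 0) :
    1 ≤ (q₁ : ℝ) ^ (n - 1 - v) * (q₂ * (S * (4 * Q) ^ (2 * n) *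
      (‖β - p₁ / q₁‖ ^ (k - v) + ‖β - p₂ / q₂‖))) := by
  have hQ : 1 ≤ Q := by linarith [norm_nonneg β]
  have hS : 0 ≤ S := (abs_nonneg _).trans (hAS 0)
  have hn : 1 ≤ n := by omega
  set f : ℤ[X] := C q₂ * A - C p₂ * B
  set a : ℂ[X] := A.map (Int.castRingHom ℂ)
  set b : ℂ[X] := B.map (Int.castRingHom ℂ)
  set r₁ : ℂ := p₁ / q₁
  set r₂ : ℂ := p₂ / q₂
  set E : ℂ[X] := a - C β * b
  have ha : a.natDegree < n := (natDegree_map_le).trans_lt hA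
  have hb : b.natDegree < n := (natDegree_map_le).trans_lt hB
  have haS (i : ℕ) : ‖a.coeff i‖ ≤ S := by simpa [a] using hAS i
  have hbS (i : ℕ) : ‖b.coeff i‖ ≤ S := by simpa [b] using hBS i
  have hE : E.natDegree < n :=
    (natDegree_sub_le _ _).trans_lt (max_lt ha ((natDegree_C_mul_le _ _).trans_lt hb))
  have hES (i : ℕ) : ‖E.coeff i‖ ≤ Q * S := by
    rw [coeff_sub, coeff_C_mul]
    calc _ ≤ ‖a.coeff i‖ + ‖β‖ * ‖b.coeff i‖ := (norm_sub_le _ _).trans (by rw [norm_mul])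
      _ ≤ S + ‖β‖ * S := by gcongr; exacts [haS i, hbS i]
      _ = (1 + ‖β‖) * S := by ring
      _ ≤ Q * S := by gcongr
  have hQ2 : (1 : ℝ) ≤ 4 * Q := by linarith
  have hn2 : (n : ℝ) ≤ 2 ^ n := by exact_mod_cast n.lt_two_pow_self.le
  have h4 : (4 : ℝ) ^ n = 2 ^ n * 2 ^ n := by rw [← mul_pow]; norm_num
  -- the values of the Hasse derivatives of `E` and `b` at `r₁`
  have hEr : ‖(hasseDeriv v E).eval r₁‖ ≤ S * (4 * Q) ^ (2 * n) * ‖β - r₁‖ ^ (k - v) := by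
    have h1 : (hasseDeriv v E).eval r₁ = (hasseDeriv v (taylor β E)).eval (r₁ - β) := by
      rw [← taylor_coeff, ← taylor_coeff, taylor_taylor, sub_add_cancel]
    have h2 (i : ℕ) : ‖(taylor β E).coeff i‖ ≤ n * (2 ^ n * (Q * S) * Q ^ n) := by
      rw [taylor_coeff]
      exact norm_eval_hasseDeriv_le hE hES hQ i (by linarith)
    have h3 : ∀ i < k, (taylor β E).coeff i = 0 := fun i hi => by
      have h := hvan i hi
      rw [← eval_map_algebraMap, ← eval_map_algebraMap, map_hasseDeriv, map_hasseDeriv] at h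
      rw [taylor_coeff]
      simp only [E, map_sub, eval_sub, ← smul_eq_C_mul, map_smul, eval_smul, smul_eq_mul]
      exact sub_eq_zero.2 h
    rw [h1]
    refine (norm_eval_hasseDeriv_le_of_coeff_eq_zero (by rwa [natDegree_taylor]) h2 h3 v
      (by rwa [norm_sub_rev])).trans ?_
    rw [norm_sub_rev r₁ β]
    calc _ = (n : ℝ) * 2 ^ n * (n * 2 ^ n) * (Q ^ n * Q ^ 1) * S * ‖β - r₁‖ ^ (k - v) := by ring
      _ ≤ (2 : ℝ) ^ n * 2 ^ n * (2 ^ n * 2 ^ n) * (Q ^ n * Q ^ n) * S * ‖β - r₁‖ ^ (k - v) := by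
        gcongr
      _ = _ := by rw [mul_pow, pow_mul', pow_mul', h4]; ring
  have hbr : ‖(hasseDeriv v b).eval r₁‖ ≤ S * (4 * Q) ^ (2 * n) := by
    have h1 : ‖r₁‖ ≤ Q := by
      have := norm_sub_norm_le r₁ β
      rw [norm_sub_rev] at this
      linarith
    refine (norm_eval_hasseDeriv_le hb hbS hQ v h1).trans ?_
    calc (n : ℝ) * (2 ^ n * S * Q ^ n) ≤ 2 ^ n * (2 ^ n * S * Q ^ n) := by gcongr
      _ = S * (4 * Q) ^ n := by rw [mul_pow, h4]; ring
      _ ≤ _ := by gcongr; omega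
  have hq₂' : (q₂ : ℂ) ≠ 0 := by exact_mod_cast hq₂.ne'
  have hid : ((hasseDeriv v f).map (Int.castRingHom ℂ)).eval r₁ =
      q₂ * ((hasseDeriv v E).eval r₁ + (β - r₂) * (hasseDeriv v b).eval r₁) := by
    have hint (z : ℤ) : (C z : ℤ[X]).map (Int.castRingHom ℂ) = C (z : ℂ) := by
      rw [map_C]; rfl
    have hf : f.map (Int.castRingHom ℂ) = C (q₂ : ℂ) * a - C (p₂ : ℂ) * b := by
      rw [Polynomial.map_sub, Polynomial.map_mul, Polynomial.map_mul, hint, hint]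
    rw [map_hasseDeriv, hf]
    simp only [E, ← smul_eq_C_mul, map_sub, map_smul, eval_sub, eval_smul, smul_eq_mul, r₂]
    field_simp
    ring
  have hlow : 1 ≤ (q₁ : ℝ) ^ (hasseDeriv v f).natDegree *
      ‖((hasseDeriv v f).map (Int.castRingHom ℂ)).eval r₁‖ := by
    have h1 := one_le_pow_mul_abs_eval_div (K := ℚ) (f := hasseDeriv v f) (a := p₁) hq₁
      (by rw [← map_hasseDeriv] at hne; exact hne)
    have h2 : ((hasseDeriv v f).map (Int.castRingHom ℂ)).eval r₁ =
        ((eval ((p₁ : ℚ) / q₁) ((hasseDeriv v f).map (algebraMap ℤ ℚ)) : ℚ) : ℂ) := by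
      rw [eval_map, eval_map, ← eq_ratCast (algebraMap ℚ ℂ), hom_eval₂]
      simp only [r₁, eq_ratCast, Rat.cast_div, Rat.cast_intCast]
      congr 1
    rw [h2, Complex.norm_ratCast]
    exact_mod_cast h1
  have hdeg : (hasseDeriv v f).natDegree ≤ n - 1 - v := by
    refine (natDegree_hasseDeriv_le _ _).trans (Nat.sub_le_sub_right ?_ _)
    have : f.natDegree < n := (natDegree_sub_le _ _).trans_lt
      (max_lt ((natDegree_C_mul_le _ _).trans_lt hA) ((natDegree_C_mul_le _ _).trans_lt hB))
    omega
  have hq₁r : (1 : ℝ) ≤ q₁ := by exact_mod_cast hq₁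
  have hq₂r : (0 : ℝ) < q₂ := by exact_mod_cast hq₂
  have hq₂n : ‖(q₂ : ℂ)‖ = q₂ := by rw [Complex.norm_intCast, abs_of_pos hq₂r]
  refine hlow.trans ?_
  rw [hid, norm_mul, hq₂n]
  gcongr ?_ ^ ?_ * (_ * ?_)
  · calc _ ≤ ‖(hasseDeriv v E).eval r₁‖ + ‖β - r₂‖ * ‖(hasseDeriv v b).eval r₁‖ :=
          (norm_add_le _ _).trans (by rw [norm_mul])
      _ ≤ S * (4 * Q) ^ (2 * n) * ‖β - r₁‖ ^ (k - v) + ‖β - r₂‖ * (S * (4 * Q) ^ (2 * n)) := by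
        gcongr
      _ = _ := by ring

theorem X_sub_C_pow_dvd_of_eval_hasseDeriv_eq_zero {R : Type*} [CommRing R] {r : R} {f : R[X]}
    {k : ℕ} (h : ∀ i < k, (hasseDeriv i f).eval r = 0) : (X - C r) ^ k ∣ f := by
  obtain ⟨g, hg⟩ : X ^ k ∣ taylor r f := by
    rw [X_pow_dvd_iff]
    exact fun i hi => (taylor_coeff r f i).trans (h i hi)
  refine ⟨g.comp (X - C r), ?_⟩
  have h1 : (taylor r f).comp (X - C r) = f := by
    rw [taylor_apply, comp_assoc]; simp
  rw [← h1, hg]; simp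

theorem exists_auxiliary_inequality {β : ℂ} (hdeg : (minpoly ℚ β).natDegree = 4)
    {b c d e : ℤ} {Q : ℝ} (hβ : β ^ 4 + b * β ^ 3 + c * β ^ 2 + d * β + e = 0)
    (hb : 1 + |(b : ℝ)| ≤ Q) (hc : 1 + |(c : ℝ)| ≤ Q) (hd : 1 + |(d : ℝ)| ≤ Q)
    (he : 1 + |(e : ℝ)| ≤ Q) (hβQ : 1 + ‖β‖ ≤ Q) {p₁ q₁ p₂ q₂ : ℤ} (hq₁ : 0 < q₁) (hq₂ : 0 < q₂)
    (hpq : IsCoprime p₁ q₁) (hr₁ : ‖β - p₁ / q₁‖ ≤ 1) {k m n : ℕ} (hk : 0 < k) (hm : 0 < m)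
    (hkm : k ≤ 3 * m) (hn : n = 2 * k + m) (hnk : n ≤ 4 * k) :
    ∃ v : ℕ, (v : ℝ) * Real.log q₁ ≤ Real.log q₁ + 13 * (n * Real.log (4 * Q)) ∧
      1 ≤ (q₁ : ℝ) ^ (n - 1 - v) * (q₂ * ((4 * Q) ^ (6 * n) * (4 * Q) ^ (2 * n) *
        (‖β - p₁ / q₁‖ ^ (k - v) + ‖β - p₂ / q₂‖))) := by
  have hint : IsIntegral ℚ β := by
    by_contra h
    rw [minpoly.eq_zero h] at hdeg
    simp at hdeg
  have hq₁r : (1 : ℝ) ≤ q₁ := by exact_mod_cast hq₁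
  have hL₁ : 0 ≤ Real.log q₁ := Real.log_nonneg hq₁r
  have hP4 : 4 ≤ 4 * Q := by linarith [abs_nonneg (b : ℝ)]
  obtain ⟨A, B, hAB, hA, hB, hAS, hBS, hvan⟩ :=
    exists_auxiliary_polynomials hβ hb hc hd he hk hm hkm hn
  have hinj : Function.Injective (Int.castRingHom ℚ) := Int.cast_injective
  have hW : wronskian A B ≠ 0 := by
    have hE : (X - C β) ^ k ∣ (A.map (Int.castRingHom ℚ)).map (algebraMap ℚ ℂ) -
        C β * (B.map (Int.castRingHom ℚ)).map (algebraMap ℚ ℂ) := by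
      refine X_sub_C_pow_dvd_of_eval_hasseDeriv_eq_zero fun i hi => ?_
      have h := hvan i hi
      rw [← eval_map_algebraMap, ← eval_map_algebraMap, map_hasseDeriv, map_hasseDeriv] at h
      rw [Polynomial.map_map, Polynomial.map_map]
      simp only [map_sub, eval_sub, ← smul_eq_C_mul, map_smul, eval_smul, smul_eq_mul]
      exact sub_eq_zero.2 h
    have h := wronskian_ne_zero_of_X_sub_C_pow_dvd hint (by omega)
      (A := A.map (Int.castRingHom ℚ)) (B := B.map (Int.castRingHom ℚ)) (k := k)
      (by simpa [Polynomial.map_eq_zero_iff hinj] using hAB)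
      (natDegree_map_le.trans_lt (by rw [hdeg]; omega))
      (natDegree_map_le.trans_lt (by rw [hdeg]; omega)) hE
    intro h0
    apply h
    have : (wronskian A B).map (Int.castRingHom ℚ) = 0 := by rw [h0, Polynomial.map_zero]
    simpa only [wronskian, Polynomial.map_sub, Polynomial.map_mul, derivative_map] using this
  have hf0 : (C q₂ * A - C p₂ * B).map (Int.castRingHom ℚ) ≠ 0 := by
    rw [Polynomial.map_ne_zero_iff hinj]
    intro h0
    have h1 : C q₂ * wronskian A B = wronskian (C q₂ * A - C p₂ * B) B := by
      simp only [wronskian, derivative_sub, derivative_mul, derivative_C]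
      ring
    rw [h0, wronskian_zero_left] at h1
    exact hW ((mul_eq_zero.1 h1).resolve_left (C_ne_zero.2 hq₂.ne'))
  have hv := pow_rootMultiplicity_sub_one_le hA hB hAS hBS hW hq₁ hpq (p₂ := p₂) hq₂.ne'
  set v := ((C q₂ * A - C p₂ * B).map (Int.castRingHom ℚ)).rootMultiplicity (p₁ / q₁ : ℚ) with hvdef
  have hne : (hasseDeriv v ((C q₂ * A - C p₂ * B).map (Int.castRingHom ℚ))).eval
      (p₁ / q₁ : ℚ) ≠ 0 := by
    rw [← taylor_coeff, hvdef, rootMultiplicity_eq_natTrailingDegree, ← taylor_apply]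
    exact trailingCoeff_nonzero_iff_nonzero.2 fun h0 => hf0 (taylor_injective _ (by rw [h0, map_zero]))
  have hvn : (v : ℝ) * Real.log q₁ ≤ Real.log q₁ + 13 * (n * Real.log (4 * Q)) := by
    have h1 : (q₁ : ℝ) ^ (v - 1) ≤ (4 * Q) ^ (13 * n) := by
      refine hv.trans ?_
      have h2 : (2 * n : ℝ) ≤ 2 ^ n := by
        have : 2 * n ≤ 2 ^ n := by
          have := (n - 1).lt_two_pow_self
          have h : 2 ^ n = 2 * 2 ^ (n - 1) := by rw [← pow_succ']; congr 1; omega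
          omega
        exact_mod_cast this
      calc (2 * n * (4 * Q) ^ (6 * n)) ^ 2 ≤ (2 ^ n * (4 * Q) ^ (6 * n)) ^ 2 := by gcongr
        _ = (2 ^ 2) ^ n * ((4 * Q) ^ (6 * n)) ^ 2 := by rw [mul_pow, pow_right_comm]
        _ ≤ (4 * Q) ^ n * ((4 * Q) ^ (6 * n)) ^ 2 := by gcongr; norm_num; linarith
        _ = _ := by ring
    have h3 := Real.log_le_log (by positivity) h1
    rw [Real.log_pow, Real.log_pow] at h3
    have h4 : (v : ℝ) ≤ ((v - 1 : ℕ) : ℝ) + 1 := by exact_mod_cast (by omega : v ≤ v - 1 + 1)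
    push_cast at h3
    nlinarith
  exact ⟨v, hvn, one_le_of_eval_hasseDeriv_ne_zero hA hB hAS hBS hvan hβQ hq₁ hq₂ hr₁ hne⟩

theorem not_two_good_approximations {β : ℂ} (hdeg : (minpoly ℚ β).natDegree = 4)
    {b c d e : ℤ} {Q : ℝ} (hβ : β ^ 4 + b * β ^ 3 + c * β ^ 2 + d * β + e = 0)
    (hb : 1 + |(b : ℝ)| ≤ Q) (hc : 1 + |(c : ℝ)| ≤ Q) (hd : 1 + |(d : ℝ)| ≤ Q)
    (he : 1 + |(e : ℝ)| ≤ Q) (hβQ : 1 + ‖β‖ ≤ Q) {p₁ q₁ p₂ q₂ : ℤ} (hq₁ : 0 < q₁) (hq₂ : 0 < q₂)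
    (hpq : IsCoprime p₁ q₁) (hr₁ : ‖β - p₁ / q₁‖ ≤ Q ^ 2 / q₁ ^ 4)
    (hr₂ : ‖β - p₂ / q₂‖ ≤ Q ^ 2 / q₂ ^ 4) (hlog₁ : 250 * Real.log (4 * Q) ≤ Real.log q₁)
    (hlog₂ : 89 * Real.log q₁ ≤ 10 * Real.log q₂) : False := by
  have hQ : 1 ≤ Q := by linarith [abs_nonneg (b : ℝ)]
  have hq₁r : (0 : ℝ) < q₁ := by exact_mod_cast hq₁
  have hq₂r : (0 : ℝ) < q₂ := by exact_mod_cast hq₂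
  obtain ⟨P, hP⟩ : ∃ P, P = 4 * Q := ⟨_, rfl⟩
  have hP1 : 1 ≤ P := by linarith
  have hP4 : 4 ≤ P := by linarith
  rw [← hP] at hlog₁
  have hμ : 0 < Real.log P := Real.log_pos (by linarith)
  generalize hμP : Real.log P = μ at *
  generalize hL₁q : Real.log q₁ = L₁ at *
  generalize hL₂q : Real.log q₂ = L₂ at *
  have hL₁ : 0 < L₁ := by linarith
  -- the parameters of the auxiliary polynomials
  obtain ⟨k, hk1, hk2⟩ : ∃ k : ℕ, (11 / 10) * L₂ ≤ k * L₁ ∧ k * L₁ < (11 / 10) * L₂ + L₁ := by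
    refine ⟨⌈(11 / 10) * L₂ / L₁⌉₊, ?_, ?_⟩
    · rw [← div_le_iff₀ hL₁]; exact Nat.le_ceil _
    · have h := Nat.ceil_lt_add_one (a := (11 / 10) * L₂ / L₁) (by
        have : 0 < L₂ := by linarith
        positivity)
      have h2 := mul_lt_mul_of_pos_right h hL₁
      rwa [add_mul, div_mul_cancel₀ _ hL₁.ne', one_mul] at h2
  have hk10 : 10 ≤ k := by
    have : (9 : ℝ) < k := by
      by_contra! h
      nlinarith
    exact_mod_cast this
  obtain ⟨m, hm1, hm2⟩ : ∃ m : ℕ, k ≤ 3 * m ∧ 3 * m ≤ k + 2 := ⟨(k + 2) / 3, by omega, by omega⟩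
  obtain ⟨n, hn⟩ : ∃ n, n = 2 * k + m := ⟨_, rfl⟩
  have hPq : P ≤ q₁ := by
    rw [← Real.log_le_log_iff (by linarith) hq₁r]
    linarith
  have hδ₁ : Q ^ 2 / (q₁ : ℝ) ^ 4 ≤ 1 := by
    rw [div_le_one (by positivity)]
    calc Q ^ 2 ≤ (q₁ : ℝ) ^ 2 := by gcongr; linarith
      _ ≤ (q₁ : ℝ) ^ 4 := by gcongr <;> linarith
  obtain ⟨v, hvn, hkey⟩ := exists_auxiliary_inequality hdeg hβ hb hc hd he hβQ hq₁ hq₂ hpq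
    (hr₁.trans hδ₁) (by omega) (by omega) hm1 hn (by omega)
  rw [← hP] at hvn hkey
  rw [hμP, hL₁q] at hvn
  have hnk : 3 * (n : ℝ) ≤ 7 * k + 2 := by exact_mod_cast (by omega : 3 * n ≤ 7 * k + 2)
  have hkr : (10 : ℝ) ≤ k := by exact_mod_cast hk10
  have hnμ : 250 * (n * μ) ≤ n * L₁ := by nlinarith [(n.cast_nonneg : (0 : ℝ) ≤ n)]
  have hkμ : 250 * (k * μ) ≤ k * L₁ := by nlinarith
  have hnL : 3 * (n * L₁) ≤ 7 * (k * L₁) + 2 * L₁ := by nlinarith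
  have hkL : 10 * L₁ ≤ k * L₁ := by nlinarith
  have hvk : v ≤ k := by
    have : (v : ℝ) * L₁ ≤ k * L₁ := by linarith
    exact_mod_cast le_of_mul_le_mul_right this hL₁
  have hvn1 : v ≤ n - 1 := by omega
  have hQP : Q ^ 2 ≤ P ^ 2 := by gcongr; linarith
  have hcase (t : ℝ) (ht : ‖β - p₁ / q₁‖ ^ (k - v) + ‖β - p₂ / q₂‖ ≤ 2 * t) (ht0 : 0 < t) :
      0 ≤ (n - 1 - v) * L₁ + L₂ + (8 * n + 1) * μ + Real.log t := by
    have h1 : 1 ≤ (q₁ : ℝ) ^ (n - 1 - v) * q₂ * P ^ (8 * n + 1) * t := by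
      refine hkey.trans ?_
      calc _ ≤ (q₁ : ℝ) ^ (n - 1 - v) * (q₂ * (P ^ (6 * n) * P ^ (2 * n) * (P * t))) := by
            gcongr
            exact ht.trans (by gcongr; linarith)
        _ = _ := by ring
    have h2 := Real.log_le_log one_pos h1
    have hnv : ((n - 1 - v : ℕ) : ℝ) = n - 1 - v := by
      rw [Nat.cast_sub hvn1, Nat.cast_sub (by omega)]; simp
    rw [Real.log_one, Real.log_mul (by positivity) ht0.ne', Real.log_mul (by positivity)
      (by positivity), Real.log_mul (by positivity) (by positivity), Real.log_pow, Real.log_pow,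
      hnv, hμP, hL₁q, hL₂q] at h2
    push_cast at h2
    exact h2
  rcases le_total (‖β - p₁ / q₁‖ ^ (k - v)) ‖β - p₂ / q₂‖ with hle | hle
  · have h := hcase (P ^ 2 / q₂ ^ 4) (by
      have := hr₂.trans (div_le_div_of_nonneg_right hQP (by positivity))
      linarith) (by positivity)
    rw [Real.log_div (by positivity) (by positivity), Real.log_pow, Real.log_pow, hμP, hL₂q] at h
    push_cast at h
    have hvL : 0 ≤ (v : ℝ) * L₁ := by positivity
    linarith
  · have h := hcase ((P ^ 2 / q₁ ^ 4) ^ (k - v)) (by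
      have h1 := hr₁.trans (div_le_div_of_nonneg_right hQP (by positivity))
      have h2 := pow_le_pow_left₀ (norm_nonneg _) h1 (k - v)
      linarith) (by positivity)
    rw [Real.log_pow, Real.log_div (by positivity) (by positivity), Real.log_pow, Real.log_pow,
      Nat.cast_sub hvk, hμP, hL₁q] at h
    push_cast at h
    have hvμ : 0 ≤ (v : ℝ) * μ := by positivity
    linarith

theorem sum_le_of_gap {α : Type*} [DecidableEq α] {h w : α → ℝ} {s : Finset α}
    (hs : ∀ z ∈ s, 0 ≤ h z)
    (hgap : ∀ z ∈ s, ∀ z' ∈ s, z ≠ z' → h z ≤ h z' → h z + w z ≤ h z') {t : ℝ} (ht : 0 ≤ t)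
    (hst : ∀ z ∈ s, h z + w z ≤ t) : ∑ z ∈ s, w z ≤ t := by
  induction s using Finset.induction_on_max_value h generalizing t with
  | empty => simpa
  | insert a s has hmax ih =>
    rw [Finset.sum_insert has]
    simp only [Finset.mem_insert, forall_eq_or_imp] at hs hgap hst
    have := ih hs.2 (fun z hz => (hgap.2 z hz).2) hs.1
      fun z hz => (hgap.2 z hz).1 (fun h => has (h ▸ hz)) (hmax z hz)
    linarith [hst.1]

theorem card_sub_mul_le_of_gap {α ι : Type*} [DecidableEq α] [Fintype ι] {S : Finset α} {h : α → ℝ}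
    {w : ι → α → ℝ} {g T : ℝ} (hg0 : 0 ≤ g) (hT0 : 0 ≤ T) (hw : ∀ i, ∀ z ∈ S, 0 ≤ w i z)
    (hh : ∀ z ∈ S, 0 ≤ h z) (hT : ∀ z ∈ S, h z ≤ T)
    (hgap : ∀ i, ∀ z ∈ S, ∀ z' ∈ S, z ≠ z' → 0 < w i z → 0 < w i z' → h z ≤ h z' →
      h z + w i z ≤ h z')
    (hg : ∀ z ∈ S, g ≤ ∑ i, w i z) :
    ((S.card : ℝ) - Fintype.card ι) * g ≤ Fintype.card ι * T := by
  classical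
  have key (i : ι) : ∃ R : Finset α, R.card ≤ 1 ∧ ∑ z ∈ S \ R, w i z ≤ T := by
    have hsum (R : Finset α) : ∑ z ∈ S \ R, w i z = ∑ z ∈ (S.filter fun z => 0 < w i z) \ R, w i z := by
      refine (Finset.sum_subset (Finset.sdiff_subset_sdiff (Finset.filter_subset _ _) le_rfl) ?_).symm
      intro z hz hz'
      simp only [Finset.mem_sdiff, Finset.mem_filter] at hz hz'
      exact le_antisymm (not_lt.1 fun h => hz' ⟨⟨hz.1, h⟩, hz.2⟩) (hw i z hz.1)
    rcases (S.filter fun z => 0 < w i z).eq_empty_or_nonempty with he | hne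
    · exact ⟨∅, by simp, by rw [hsum, he]; simpa⟩
    · obtain ⟨m, hm, hmax⟩ := Finset.exists_max_image _ h hne
      refine ⟨{m}, by simp, ?_⟩
      rw [hsum]
      rw [Finset.mem_filter] at hm
      refine (sum_le_of_gap (h := h) (t := h m) ?_ ?_ (hh m hm.1) ?_).trans (hT m hm.1)
      · intro z hz
        simp only [Finset.mem_sdiff, Finset.mem_filter] at hz
        exact hh z hz.1.1
      · intro z hz z' hz'
        simp only [Finset.mem_sdiff, Finset.mem_filter] at hz hz'
        exact fun hne => hgap i z hz.1.1 z' hz'.1.1 hne hz.1.2 hz'.1.2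
      · intro z hz
        have hz0 := (Finset.mem_sdiff.1 hz).1
        simp only [Finset.mem_sdiff, Finset.mem_filter, Finset.mem_singleton] at hz
        exact hgap i z hz.1.1 m hm.1 hz.2 hz.1.2 hm.2 (hmax z hz0)
  choose R hR1 hR using key
  set U := Finset.univ.biUnion R
  have hU : U.card ≤ Fintype.card ι :=
    (Finset.card_biUnion_le_card_mul _ _ 1 fun i _ => hR1 i).trans (by simp)
  have h1 : ((S \ U).card : ℝ) * g ≤ Fintype.card ι * T := by
    calc ((S \ U).card : ℝ) * g = ∑ z ∈ S \ U, g := by simp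
      _ ≤ ∑ z ∈ S \ U, ∑ i, w i z := Finset.sum_le_sum fun z hz => hg z (Finset.sdiff_subset hz)
      _ = ∑ i, ∑ z ∈ S \ U, w i z := Finset.sum_comm
      _ ≤ ∑ i, ∑ z ∈ S \ R i, w i z := Finset.sum_le_sum fun i _ =>
          Finset.sum_le_sum_of_subset_of_nonneg (Finset.sdiff_subset_sdiff le_rfl
            (Finset.subset_biUnion_of_mem R (Finset.mem_univ i)))
            fun z hz _ => hw i z (Finset.sdiff_subset hz)
      _ ≤ ∑ _i : ι, T := Finset.sum_le_sum fun i _ => hR i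
      _ = _ := by simp
  have h2 : (S.card : ℝ) ≤ (S \ U).card + Fintype.card ι := by
    exact_mod_cast (Finset.card_le_card_sdiff_add_card (s := S) (t := U)).trans (by omega)
  nlinarith

theorem exists_subset_of_triple_gap {α : Type*} [DecidableEq α] {u : α → ℝ} {s : Finset α}
    (hgap : ∀ z ∈ s, ∀ z' ∈ s, z ≠ z' → u z ≤ u z' → 3 * u z ≤ u z') {t : ℝ}
    (ht : ∀ z ∈ s, t ≤ u z) : ∃ s' ⊆ s, s.card ≤ s'.card + 1 ∧ ∀ z ∈ s', 3 * t ≤ u z := by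
  rcases s.eq_empty_or_nonempty with rfl | hne
  · exact ⟨∅, by simp⟩
  · obtain ⟨m, hm, hmin⟩ := Finset.exists_min_image s u hne
    refine ⟨s.erase m, Finset.erase_subset _ _, by rw [Finset.card_erase_of_mem hm]; omega, ?_⟩
    intro z hz
    rw [Finset.mem_erase] at hz
    have := hgap m hm z hz.2 hz.1.symm (hmin z hz.2)
    linarith [ht m hm]

theorem exists_pair_of_triple_gap {α : Type*} [DecidableEq α] {u : α → ℝ} {s : Finset α}
    (hgap : ∀ z ∈ s, ∀ z' ∈ s, z ≠ z' → u z ≤ u z' → 3 * u z ≤ u z') {t : ℝ}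
    (ht : ∀ z ∈ s, t ≤ u z) (hs : 8 ≤ s.card) :
    ∃ z₁ ∈ s, ∃ z₂ ∈ s, 243 * t ≤ u z₁ ∧ 9 * u z₁ ≤ u z₂ := by
  have key (j : ℕ) : ∃ s' ⊆ s, s.card ≤ s'.card + j ∧ ∀ z ∈ s', 3 ^ j * t ≤ u z := by
    induction j with
    | zero => exact ⟨s, subset_rfl, by simp, by simpa⟩
    | succ j ih =>
      obtain ⟨s₁, hs₁, hc₁, ht₁⟩ := ih
      obtain ⟨s₂, hs₂, hc₂, ht₂⟩ := exists_subset_of_triple_gap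
        (fun z hz z' hz' => hgap z (hs₁ hz) z' (hs₁ hz')) ht₁
      exact ⟨s₂, hs₂.trans hs₁, by omega, fun z hz => by rw [pow_succ']; linarith [ht₂ z hz]⟩
  obtain ⟨s₅, hs₅, hc₅, ht₅⟩ := key 5
  obtain ⟨m, hm, hmin⟩ := Finset.exists_min_image s₅ u (Finset.card_pos.1 (by omega))
  obtain ⟨s₆, hs₆, hc₆, ht₆⟩ := exists_subset_of_triple_gap (s := s₅.erase m) (t := 3 * u m)
    (fun z hz z' hz' => hgap z (hs₅ (Finset.erase_subset _ _ hz)) z'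
      (hs₅ (Finset.erase_subset _ _ hz')))
    (fun z hz => by
      rw [Finset.mem_erase] at hz
      exact hgap m (hs₅ hm) z (hs₅ hz.2) hz.1.symm (hmin z hz.2))
  rw [Finset.card_erase_of_mem hm] at hc₆
  obtain ⟨z, hz⟩ := Finset.card_pos.1 (by omega : 0 < s₆.card)
  refine ⟨m, hs₅ hm, z, hs₅ (Finset.erase_subset _ _ (hs₆ hz)), ?_, ?_⟩
  · linarith [ht₅ m hm]
  · linarith [ht₆ z hz]

theorem one_le_of_ne_of_isCoprime {β : ℂ} {x y x' y' : ℤ} (hy : 0 < y) (hy' : 0 < y')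
    (hc : IsCoprime x y) (hc' : IsCoprime x' y') (hne : (x, y) ≠ (x', y')) :
    1 ≤ y' * ‖(x : ℂ) - β * y‖ + y * ‖(x' : ℂ) - β * y'‖ := by
  have h1 : x * y' - x' * y ≠ 0 := by
    intro h0
    have h2 : x * y' = x' * y := sub_eq_zero.1 h0
    have hyy : y = y' := by
      refine Int.dvd_antisymm hy.le hy'.le ?_ ?_
      · exact hc.symm.dvd_of_dvd_mul_left ⟨x', by rw [h2, mul_comm]⟩
      · exact hc'.symm.dvd_of_dvd_mul_left ⟨x, by rw [← h2, mul_comm]⟩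
    subst hyy
    exact hne (by rw [mul_right_cancel₀ hy.ne' h2])
  have h3 : (1 : ℝ) ≤ ‖((x * y' - x' * y : ℤ) : ℂ)‖ := by
    rw [Complex.norm_intCast]
    exact_mod_cast Int.one_le_abs h1
  have h4 : ((x * y' - x' * y : ℤ) : ℂ) = y' * ((x : ℂ) - β * y) - y * (x' - β * y') := by
    push_cast; ring
  rw [h4] at h3
  refine h3.trans ((norm_sub_le _ _).trans ?_)
  rw [norm_mul, norm_mul, Complex.norm_intCast, Complex.norm_intCast,
    abs_of_pos (by exact_mod_cast hy'), abs_of_pos (by exact_mod_cast hy)]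

theorem exists_norm_sub_div_le {β : Fin 4 → ℂ} {Q d₀ : ℝ}
    (hd₀ : ∀ i, d₀ ≤ (∏ j ∈ Finset.univ.erase i, ‖β i - β j‖) * Q ^ 2) {x y : ℤ} (hy : 0 < y)
    (h : ∏ i, ‖(x : ℂ) - β i * y‖ = 1) :
    ∃ i, ‖β i - x / y‖ * d₀ ≤ 8 * Q ^ 2 / y ^ 4 := by
  have hyr : (0 : ℝ) < y := by exact_mod_cast hy
  have hyc : (y : ℂ) ≠ 0 := by exact_mod_cast hy.ne'
  obtain ⟨i, -, hi⟩ := Finset.exists_min_image Finset.univ (fun i => ‖β i - x / y‖)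
    Finset.univ_nonempty
  refine ⟨i, ?_⟩
  have h1 (j : Fin 4) : ‖(x : ℂ) - β j * y‖ = ‖β j - x / y‖ * y := by
    have : (x : ℂ) - β j * y = -((β j - x / y) * y) := by field_simp; ring
    rw [this, norm_neg, norm_mul, Complex.norm_intCast, abs_of_pos hyr]
  have h2 : (∏ j, ‖β j - x / y‖) * y ^ 4 = 1 := by
    rw [← h, Finset.prod_congr rfl fun j _ => h1 j, Finset.prod_mul_distrib]
    simp
  have h3 : (∏ j ∈ Finset.univ.erase i, ‖β i - β j‖) ≤
      8 * ∏ j ∈ Finset.univ.erase i, ‖β j - x / y‖ := by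
    calc _ ≤ ∏ j ∈ Finset.univ.erase i, (2 * ‖β j - x / y‖) := by
          refine Finset.prod_le_prod (fun j _ => norm_nonneg _) fun j _ => ?_
          have h4 := norm_sub_le (β i - x / y) (β j - x / y)
          rw [sub_sub_sub_cancel_right] at h4
          linarith [hi j (Finset.mem_univ j)]
      _ = _ := by
          rw [Finset.prod_mul_distrib, Finset.prod_const, Finset.card_erase_of_mem (Finset.mem_univ i)]
          norm_num
  rw [le_div_iff₀ (by positivity)]
  calc ‖β i - x / y‖ * d₀ * y ^ 4
      ≤ ‖β i - x / y‖ * ((8 * ∏ j ∈ Finset.univ.erase i, ‖β j - x / y‖) * Q ^ 2) * y ^ 4 := by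
        gcongr
        exact (hd₀ i).trans (by gcongr)
    _ = 8 * Q ^ 2 * ((‖β i - x / y‖ * ∏ j ∈ Finset.univ.erase i, ‖β j - x / y‖) * y ^ 4) := by ring
    _ = 8 * Q ^ 2 := by
        rw [Finset.mul_prod_erase _ (fun j => ‖β j - x / y‖) (Finset.mem_univ i), h2, mul_one]

theorem card_le_seven_of_large {β : ℂ} (hdeg : (minpoly ℚ β).natDegree = 4)
    {b c d e : ℤ} {Q d₀ g : ℝ} (hβ : β ^ 4 + b * β ^ 3 + c * β ^ 2 + d * β + e = 0)
    (hb : 1 + |(b : ℝ)| ≤ Q) (hc : 1 + |(c : ℝ)| ≤ Q) (hd : 1 + |(d : ℝ)| ≤ Q)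
    (he : 1 + |(e : ℝ)| ≤ Q) (hβQ : 1 + ‖β‖ ≤ Q) (hd₀ : 29000 ≤ d₀) (hg : 0 ≤ g)
    (hQg : Real.log Q ≤ 5.03 + g) {S : Finset (ℤ × ℤ)} (hS0 : ∀ z ∈ S, 0 < z.2)
    (hScop : ∀ z ∈ S, IsCoprime z.1 z.2) (hSlarge : ∀ z ∈ S, 8.5 + 2.5 * g ≤ Real.log z.2)
    (hS : ∀ z ∈ S, ‖β - z.1 / z.2‖ * d₀ ≤ 8 * Q ^ 2 / z.2 ^ 4) : S.card ≤ 7 := by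
  by_contra! hcard
  have hQ : 1 ≤ Q := by linarith [norm_nonneg β]
  have hlogQ : 0 ≤ Real.log Q := Real.log_nonneg hQ
  set μ := Real.log Q - 3.5 with hμ
  have hgap : ∀ z ∈ S, ∀ z' ∈ S, z ≠ z' → Real.log z.2 - μ ≤ Real.log z'.2 - μ →
      3 * (Real.log z.2 - μ) ≤ Real.log z'.2 - μ := by
    intro z hz z' hz' hne hle
    have hy : (0 : ℝ) < z.2 := by exact_mod_cast hS0 z hz
    have hy' : (0 : ℝ) < z'.2 := by exact_mod_cast hS0 z' hz'
    have hyy : (z.2 : ℝ) ≤ z'.2 := (Real.log_le_log_iff hy hy').1 (by linarith)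
    have h1 := one_le_of_ne_of_isCoprime (β := β) (hS0 z hz) (hS0 z' hz') (hScop z hz)
      (hScop z' hz') hne
    have hL : ∀ w ∈ S, ‖(w.1 : ℂ) - β * w.2‖ * (d₀ * w.2 ^ 3) ≤ 8 * Q ^ 2 := fun w hw => by
      have hw0 : (0 : ℝ) < w.2 := by exact_mod_cast hS0 w hw
      have hwc : (w.2 : ℂ) ≠ 0 := by exact_mod_cast (hS0 w hw).ne'
      have h2 : (w.1 : ℂ) - β * w.2 = -((β - w.1 / w.2) * w.2) := by field_simp; ring
      rw [h2, norm_neg, norm_mul, Complex.norm_intCast, abs_of_pos hw0]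
      have h3 := hS w hw
      rw [le_div_iff₀ (by positivity)] at h3
      linarith
    have h2 := hL z hz
    have h3 : ‖(z'.1 : ℂ) - β * z'.2‖ * (d₀ * z.2 ^ 3) ≤ 8 * Q ^ 2 :=
      le_trans (by gcongr) (hL z' hz')
    have h4 : d₀ * z.2 ^ 3 ≤ 16 * Q ^ 2 * z'.2 := by
      calc d₀ * z.2 ^ 3 = 1 * (d₀ * (z.2 : ℝ) ^ 3) := by ring
        _ ≤ (z'.2 * ‖(z.1 : ℂ) - β * z.2‖ + z.2 * ‖(z'.1 : ℂ) - β * z'.2‖) * (d₀ * z.2 ^ 3) := by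
          gcongr
        _ = z'.2 * (‖(z.1 : ℂ) - β * z.2‖ * (d₀ * z.2 ^ 3)) +
            z.2 * (‖(z'.1 : ℂ) - β * z'.2‖ * (d₀ * z.2 ^ 3)) := by ring
        _ ≤ z'.2 * (8 * Q ^ 2) + z'.2 * (8 * Q ^ 2) := by gcongr
        _ = _ := by ring
    have h5 : Real.exp 7 * 16 ≤ d₀ := by
      have h6 : Real.exp 7 = Real.exp 1 ^ 7 := by rw [← Real.exp_nat_mul]; norm_num
      have h7 : Real.exp 1 ^ 7 ≤ 2.7182818286 ^ 7 := by
        gcongr; exact Real.exp_one_lt_d9.le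
      rw [h6]
      norm_num at h7 ⊢
      linarith
    have h6 : Real.exp 7 * z.2 ^ 3 ≤ Q ^ 2 * z'.2 := by
      have h7 := mul_le_mul_of_nonneg_right h5 (by positivity : 0 ≤ (z.2 : ℝ) ^ 3)
      linarith
    have h7 := Real.log_le_log (by positivity) h6
    rw [Real.log_mul (by positivity) (by positivity), Real.log_mul (by positivity) (by positivity),
      Real.log_exp, Real.log_pow, Real.log_pow] at h7
    push_cast at h7
    linarith
  obtain ⟨z₁, hz₁, z₂, hz₂, h₁, h₂⟩ := exists_pair_of_triple_gap hgap
    (t := 1.5 * g + 6.97) (fun z hz => by linarith [hSlarge z hz]) hcard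
  have hlog4 : Real.log (4 * Q) ≤ 1.39 + Real.log Q := by
    rw [Real.log_mul (by norm_num) (by positivity), show (4 : ℝ) = 2 ^ 2 by norm_num, Real.log_pow]
    push_cast
    linarith [Real.log_two_lt_d9]
  have happ : ∀ w ∈ S, ‖β - w.1 / w.2‖ ≤ Q ^ 2 / w.2 ^ 4 := fun w hw => by
    have hw0 : (0 : ℝ) < w.2 := by exact_mod_cast hS0 w hw
    have h3 := hS w hw
    rw [le_div_iff₀ (by positivity)] at h3 ⊢
    have h4 : 0 ≤ ‖β - w.1 / w.2‖ * w.2 ^ 4 := by positivity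
    nlinarith
  refine not_two_good_approximations hdeg hβ hb hc hd he hβQ (hS0 z₁ hz₁) (hS0 z₂ hz₂)
    (hScop z₁ hz₁) (happ z₁ hz₁) (happ z₂ hz₂) ?_ ?_
  · linarith
  · linarith

theorem card_mul_le_of_solutions {β : Fin 4 → ℂ} (hdeg : ∀ i, (minpoly ℚ (β i)).natDegree = 4)
    {b c d e : ℤ} {Q d₀ G : ℝ}
    (hβ : ∀ i, β i ^ 4 + b * β i ^ 3 + c * β i ^ 2 + d * β i + e = 0)
    (hb : 1 + |(b : ℝ)| ≤ Q) (hc : 1 + |(c : ℝ)| ≤ Q) (hd : 1 + |(d : ℝ)| ≤ Q)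
    (he : 1 + |(e : ℝ)| ≤ Q) (hβQ : ∀ i, 1 + ‖β i‖ ≤ Q) (hd₀ : 29000 ≤ d₀)
    (hd₀Q : ∀ i, d₀ ≤ (∏ j ∈ Finset.univ.erase i, ‖β i - β j‖) * Q ^ 2)
    (hG : 1 ≤ G) (hQG : Q ≤ 152 * G) {S : Finset (ℤ × ℤ)} (hS0 : ∀ z ∈ S, 0 < z.2)
    (hScop : ∀ z ∈ S, IsCoprime z.1 z.2) (hS : ∀ z ∈ S, ∏ i, ‖(z.1 : ℂ) - β i * z.2‖ = 1)
    (hSG : ∀ z ∈ S, G ≤ ∏ i, max 1 (1 / (2 * z.2 * ‖(z.1 : ℂ) - β i * z.2‖))) :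
    S.card * Real.log G ≤ 42 * Real.log G + 34 := by
  classical
  have hg : 0 ≤ Real.log G := Real.log_nonneg hG
  have hQg : Real.log Q ≤ 5.03 + Real.log G := by
    have hQ : 0 < Q := by linarith [abs_nonneg (b : ℝ)]
    have h1 := Real.log_le_log hQ hQG
    rw [Real.log_mul (by norm_num) (by positivity)] at h1
    have h2 : Real.log 152 ≤ 5.03 := by
      rw [Real.log_le_iff_le_exp (by norm_num), show (5.03 : ℝ) = 5 * 1 + 0.03 by norm_num,
        Real.exp_add, mul_comm (5 : ℝ), Real.exp_mul]
      have h3 : (2.718 : ℝ) ≤ Real.exp 1 := by linarith [Real.exp_one_gt_d9]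
      have h4 : (1.03 : ℝ) ≤ Real.exp 0.03 := by linarith [Real.add_one_le_exp (0.03 : ℝ)]
      calc (152 : ℝ) ≤ 2.718 ^ (5 : ℝ) * 1.03 := by norm_num
        _ ≤ _ := by gcongr
    linarith
  set T := 8.5 + 2.5 * Real.log G with hT
  have hsmall := card_sub_mul_le_of_gap (S := S.filter fun z => Real.log z.2 ≤ T)
    (h := fun z => Real.log z.2)
    (w := fun i z => Real.log (max 1 (1 / (2 * z.2 * ‖(z.1 : ℂ) - β i * z.2‖)))) (T := T) hg
    (by linarith) (fun i z _ => Real.log_nonneg (le_max_left _ _))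
    (fun z hz => Real.log_nonneg (by exact_mod_cast hS0 z (Finset.mem_of_mem_filter z hz)))
    (fun z hz => (Finset.mem_filter.1 hz).2) ?_ ?_
  · have hlarge : (S.filter fun z => ¬ Real.log z.2 ≤ T).card ≤ 28 := by
      have hex : ∀ z : ℤ × ℤ, ∃ i, z ∈ S → ‖β i - z.1 / z.2‖ * d₀ ≤ 8 * Q ^ 2 / z.2 ^ 4 := fun z => by
        by_cases hz : z ∈ S
        · obtain ⟨i, hi⟩ := exists_norm_sub_div_le hd₀Q (hS0 z hz) (hS z hz)
          exact ⟨i, fun _ => hi⟩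
        · exact ⟨0, fun h => absurd h hz⟩
      choose φ hφ using hex
      have h7 := Finset.card_le_mul_card_image_of_maps_to (f := φ)
        (s := S.filter fun z => ¬ Real.log z.2 ≤ T) (t := Finset.univ)
        (fun _ _ => Finset.mem_univ _) 7 fun i _ => by
          refine card_le_seven_of_large (hdeg i) (hβ i) hb hc hd he (hβQ i) hd₀ hg hQg ?_ ?_ ?_ ?_
          · exact fun z hz => hS0 z (Finset.mem_of_mem_filter z (Finset.mem_of_mem_filter z hz))
          · exact fun z hz => hScop z (Finset.mem_of_mem_filter z (Finset.mem_of_mem_filter z hz))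
          · intro z hz
            simp only [Finset.mem_filter, not_le] at hz
            exact hz.1.2.le
          · intro z hz
            rw [Finset.mem_filter] at hz
            rw [← hz.2]
            exact hφ z (Finset.mem_of_mem_filter z hz.1)
      simpa using h7
    have hcard := Finset.card_filter_add_card_filter_not (s := S) fun z => Real.log z.2 ≤ T
    have hcard' : (S.card : ℝ) ≤ (S.filter fun z => Real.log z.2 ≤ T).card + 28 := by
      exact_mod_cast (by omega)
    simp only [Fintype.card_fin] at hsmall
    push_cast at hsmall
    nlinarith
  · intro i z hz z' hz' hne hw hw' hle
    replace hz := Finset.mem_of_mem_filter z hz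
    replace hz' := Finset.mem_of_mem_filter z' hz'
    have hy : (0 : ℝ) < z.2 := by exact_mod_cast hS0 z hz
    have hy' : (0 : ℝ) < z'.2 := by exact_mod_cast hS0 z' hz'
    have hyy : (z.2 : ℝ) ≤ z'.2 := (Real.log_le_log_iff hy hy').1 hle
    have h1 := one_le_of_ne_of_isCoprime (β := β i) (hS0 z hz) (hS0 z' hz') (hScop z hz)
      (hScop z' hz') hne
    have hpos : ∀ w : ℤ × ℤ, 0 < Real.log (max 1 (1 / (2 * w.2 * ‖(w.1 : ℂ) - β i * w.2‖))) →
        1 < 1 / (2 * w.2 * ‖(w.1 : ℂ) - β i * w.2‖) := fun w hw => by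
      by_contra! h
      rw [max_eq_left h, Real.log_one] at hw
      exact lt_irrefl _ hw
    have h2 := hpos z hw
    have h3 := hpos z' hw'
    have hL : 0 < 2 * z.2 * ‖(z.1 : ℂ) - β i * z.2‖ := by
      by_contra! h
      linarith [one_div_nonpos.2 h]
    have hL' : 0 < 2 * z'.2 * ‖(z'.1 : ℂ) - β i * z'.2‖ := by
      by_contra! h
      linarith [one_div_nonpos.2 h]
    have hLz : 0 < ‖(z.1 : ℂ) - β i * z.2‖ := pos_of_mul_pos_right hL (by positivity)
    rw [lt_div_iff₀ hL', one_mul] at h3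
    have h4 : (z.2 : ℝ) * ‖(z'.1 : ℂ) - β i * z'.2‖ ≤ z'.2 * ‖(z'.1 : ℂ) - β i * z'.2‖ := by gcongr
    rw [max_eq_right h2.le, ← Real.log_mul hy.ne' (by positivity)]
    refine Real.log_le_log (by positivity) ?_
    rw [mul_one_div, div_le_iff₀ hL]
    nlinarith
  · intro z hz
    replace hz := Finset.mem_of_mem_filter z hz
    rw [← Real.log_prod fun i _ => (by positivity)]
    exact Real.log_le_log (by positivity) (hSG z hz)

theorem norm_vandermonde_le {z : Fin 4 → ℂ} {m : Fin 4 → ℝ} {r : ℝ} (hr : 0 ≤ r) (hm : ∀ i, 1 ≤ m i)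
    (hz : ∀ i j, ‖z i - z j‖ ≤ r * (m i * m j)) :
    ‖(z 0 - z 1) * (z 0 - z 2) * (z 0 - z 3) * (z 1 - z 2) * (z 1 - z 3) * (z 2 - z 3)‖ ≤
      r ^ 6 * (∏ i, m i) ^ 3 := by
  have hm0 : ∀ i, 0 ≤ m i := fun i => zero_le_one.trans (hm i)
  have := hm0 0
  have := hm0 1
  have := hm0 2
  have := hm0 3
  simp only [norm_mul]
  calc _ ≤ r * (m 0 * m 1) * (r * (m 0 * m 2)) * (r * (m 0 * m 3)) * (r * (m 1 * m 2)) *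
        (r * (m 1 * m 3)) * (r * (m 2 * m 3)) := by gcongr <;> apply hz
    _ = _ := by rw [Fin.prod_univ_four]; ring

theorem norm_vandermonde_le_prod_erase {z : Fin 4 → ℂ} (i : Fin 4) :
    ‖(z 0 - z 1) * (z 0 - z 2) * (z 0 - z 3) * (z 1 - z 2) * (z 1 - z 3) * (z 2 - z 3)‖ ≤
      (∏ j ∈ Finset.univ.erase i, ‖z i - z j‖) * (∏ i, (1 + ‖z i‖)) ^ 2 := by
  have hsub : ∀ i j, ‖z i - z j‖ ≤ (1 + ‖z i‖) * (1 + ‖z j‖) := fun i j => by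
    nlinarith [norm_sub_le (z i) (z j), norm_nonneg (z i), norm_nonneg (z j),
      mul_nonneg (norm_nonneg (z i)) (norm_nonneg (z j))]
  have key : ∀ (t : ℝ) (i j k l : Fin 4), 0 ≤ t →
      t * (‖z j - z k‖ * ‖z j - z l‖ * ‖z k - z l‖) ≤
        t * ((1 + ‖z i‖) * (1 + ‖z j‖) * (1 + ‖z k‖) * (1 + ‖z l‖)) ^ 2 := fun t i j k l ht => by
    refine mul_le_mul_of_nonneg_left ?_ ht
    calc ‖z j - z k‖ * ‖z j - z l‖ * ‖z k - z l‖ ≤ (1 + ‖z j‖) * (1 + ‖z k‖) *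
          ((1 + ‖z j‖) * (1 + ‖z l‖)) * ((1 + ‖z k‖) * (1 + ‖z l‖)) := by gcongr <;> apply hsub
      _ = 1 * ((1 + ‖z j‖) * (1 + ‖z k‖) * (1 + ‖z l‖)) ^ 2 := by ring
      _ ≤ (1 + ‖z i‖) ^ 2 * ((1 + ‖z j‖) * (1 + ‖z k‖) * (1 + ‖z l‖)) ^ 2 := by
        gcongr
        nlinarith [norm_nonneg (z i)]
      _ = _ := by ring
  have h01 := norm_sub_rev (z 0) (z 1)
  have h02 := norm_sub_rev (z 0) (z 2)
  have h03 := norm_sub_rev (z 0) (z 3)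
  have h12 := norm_sub_rev (z 1) (z 2)
  have h13 := norm_sub_rev (z 1) (z 3)
  have h23 := norm_sub_rev (z 2) (z 3)
  simp only [norm_mul, Fin.prod_univ_four]
  fin_cases i
  · rw [show Finset.univ.erase (⟨0, by decide⟩ : Fin 4) = {1, 2, 3} by decide]
    rw [Finset.prod_insert (by decide), Finset.prod_insert (by decide), Finset.prod_singleton]
    convert key _ 0 1 2 3 (by positivity : 0 ≤ ‖z 0 - z 1‖ * (‖z 0 - z 2‖ * ‖z 0 - z 3‖)) using 1
    · ring
    · simp only [Fin.zero_eta]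
  · rw [show Finset.univ.erase (⟨1, by decide⟩ : Fin 4) = {0, 2, 3} by decide]
    rw [Finset.prod_insert (by decide), Finset.prod_insert (by decide), Finset.prod_singleton]
    convert key _ 1 0 2 3 (by positivity : 0 ≤ ‖z 1 - z 0‖ * (‖z 1 - z 2‖ * ‖z 1 - z 3‖)) using 1
    · rw [h01]; ring
    · simp only [Fin.mk_one]; ring
  · rw [show Finset.univ.erase (⟨2, by decide⟩ : Fin 4) = {0, 1, 3} by decide]
    rw [Finset.prod_insert (by decide), Finset.prod_insert (by decide), Finset.prod_singleton]
    convert key _ 2 0 1 3 (by positivity : 0 ≤ ‖z 2 - z 0‖ * (‖z 2 - z 1‖ * ‖z 2 - z 3‖)) using 1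
    · rw [h02, h12]; ring
    · simp only [Fin.reduceFinMk]; ring
  · rw [show Finset.univ.erase (⟨3, by decide⟩ : Fin 4) = {0, 1, 2} by decide]
    rw [Finset.prod_insert (by decide), Finset.prod_insert (by decide), Finset.prod_singleton]
    convert key _ 3 0 1 2 (by positivity : 0 ≤ ‖z 3 - z 0‖ * (‖z 3 - z 1‖ * ‖z 3 - z 2‖)) using 1
    · rw [h03, h13, h23]; ring
    · simp only [Fin.reduceFinMk]; ring

theorem quartic_coeff_bounds {β : Fin 4 → ℂ} {b c d e : ℤ}
    (hfac : ∀ X : ℂ, X ^ 4 + b * X ^ 3 + c * X ^ 2 + d * X + e = ∏ i, (X - β i)) :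
    1 + |(b : ℝ)| ≤ ∏ i, (1 + ‖β i‖) ∧ 1 + |(c : ℝ)| ≤ ∏ i, (1 + ‖β i‖) ∧
      1 + |(d : ℝ)| ≤ ∏ i, (1 + ‖β i‖) ∧ 1 + |(e : ℝ)| ≤ ∏ i, (1 + ‖β i‖) := by
  simp only [Fin.prod_univ_four] at hfac ⊢
  have h0 := hfac 0
  have h1 := hfac 1
  have h2 := hfac (-1)
  have h3 := hfac 2
  have he : (e : ℂ) = β 0 * β 1 * β 2 * β 3 := by linear_combination h0
  have hc : (c : ℂ) = β 0 * β 1 + β 0 * β 2 + β 0 * β 3 + β 1 * β 2 + β 1 * β 3 + β 2 * β 3 := by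
    linear_combination (h1 + h2) / 2 - h0
  have hb : (b : ℂ) = -(β 0 + β 1 + β 2 + β 3) := by
    linear_combination (h3 - h0 - 4 * ((h1 + h2) / 2 - h0) - (h1 - h2)) / 6
  have hd : (d : ℂ) =
      -(β 0 * β 1 * β 2 + β 0 * β 1 * β 3 + β 0 * β 2 * β 3 + β 1 * β 2 * β 3) := by
    linear_combination (h1 - h2) / 2 - (h3 - h0 - 4 * ((h1 + h2) / 2 - h0) - (h1 - h2)) / 6
  have n0 := norm_nonneg (β 0)
  have n1 := norm_nonneg (β 1)
  have n2 := norm_nonneg (β 2)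
  have n3 := norm_nonneg (β 3)
  have hexp : (1 + ‖β 0‖) * (1 + ‖β 1‖) * (1 + ‖β 2‖) * (1 + ‖β 3‖) = 1 +
      (‖β 0‖ + ‖β 1‖ + ‖β 2‖ + ‖β 3‖) +
      (‖β 0‖ * ‖β 1‖ + ‖β 0‖ * ‖β 2‖ + ‖β 0‖ * ‖β 3‖ + ‖β 1‖ * ‖β 2‖ + ‖β 1‖ * ‖β 3‖ + ‖β 2‖ * ‖β 3‖) +
      (‖β 0‖ * ‖β 1‖ * ‖β 2‖ + ‖β 0‖ * ‖β 1‖ * ‖β 3‖ + ‖β 0‖ * ‖β 2‖ * ‖β 3‖ + ‖β 1‖ * ‖β 2‖ * ‖β 3‖) +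
      ‖β 0‖ * ‖β 1‖ * ‖β 2‖ * ‖β 3‖ := by ring
  rw [hexp]
  have p1 : 0 ≤ ‖β 0‖ + ‖β 1‖ + ‖β 2‖ + ‖β 3‖ := by positivity
  have p2 : 0 ≤ ‖β 0‖ * ‖β 1‖ + ‖β 0‖ * ‖β 2‖ + ‖β 0‖ * ‖β 3‖ + ‖β 1‖ * ‖β 2‖ + ‖β 1‖ * ‖β 3‖ +
    ‖β 2‖ * ‖β 3‖ := by positivity
  have p3 : 0 ≤ ‖β 0‖ * ‖β 1‖ * ‖β 2‖ + ‖β 0‖ * ‖β 1‖ * ‖β 3‖ + ‖β 0‖ * ‖β 2‖ * ‖β 3‖ +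
    ‖β 1‖ * ‖β 2‖ * ‖β 3‖ := by positivity
  have p4 : 0 ≤ ‖β 0‖ * ‖β 1‖ * ‖β 2‖ * ‖β 3‖ := by positivity
  simp only [← Complex.norm_intCast, hb, hc, hd, he, norm_neg]
  refine ⟨?_, ?_, ?_, ?_⟩
  · have : ‖β 0 + β 1 + β 2 + β 3‖ ≤ ‖β 0‖ + ‖β 1‖ + ‖β 2‖ + ‖β 3‖ := by
      iterate 3 refine (norm_add_le _ _).trans (add_le_add_left ?_ _)
      rfl
    linarith
  · have : ‖β 0 * β 1 + β 0 * β 2 + β 0 * β 3 + β 1 * β 2 + β 1 * β 3 + β 2 * β 3‖ ≤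
        ‖β 0‖ * ‖β 1‖ + ‖β 0‖ * ‖β 2‖ + ‖β 0‖ * ‖β 3‖ + ‖β 1‖ * ‖β 2‖ + ‖β 1‖ * ‖β 3‖ +
          ‖β 2‖ * ‖β 3‖ := by
      simp only [← norm_mul]
      iterate 5 refine (norm_add_le _ _).trans (add_le_add_left ?_ _)
      rfl
    linarith
  · have : ‖β 0 * β 1 * β 2 + β 0 * β 1 * β 3 + β 0 * β 2 * β 3 + β 1 * β 2 * β 3‖ ≤
        ‖β 0‖ * ‖β 1‖ * ‖β 2‖ + ‖β 0‖ * ‖β 1‖ * ‖β 3‖ + ‖β 0‖ * ‖β 2‖ * ‖β 3‖ +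
          ‖β 1‖ * ‖β 2‖ * ‖β 3‖ := by
      simp only [← norm_mul]
      iterate 3 refine (norm_add_le _ _).trans (add_le_add_left ?_ _)
      rfl
    linarith
  · simp only [norm_mul]
    linarith

theorem card_mul_le_of_monic {β : Fin 4 → ℂ} (hdeg : ∀ i, (minpoly ℚ (β i)).natDegree = 4)
    {b c d e : ℤ}
    (hfac : ∀ X : ℂ, X ^ 4 + b * X ^ 3 + c * X ^ 2 + d * X + e = ∏ i, (X - β i))
    (hβ : 29000 ≤ ‖(β 0 - β 1) * (β 0 - β 2) * (β 0 - β 3) * (β 1 - β 2) * (β 1 - β 3) *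
      (β 2 - β 3)‖) {G : ℝ} (hG : 1 ≤ G) (hβG : ∏ i, (1 + ‖β i‖) ≤ 152 * G)
    {S : Finset (ℤ × ℤ)} (hS0 : ∀ z ∈ S, 0 < z.2)
    (hScop : ∀ z ∈ S, IsCoprime z.1 z.2) (hS : ∀ z ∈ S, ∏ i, ‖(z.1 : ℂ) - β i * z.2‖ = 1)
    (hSG : ∀ z ∈ S, G ≤ ∏ i, max 1 (1 / (2 * z.2 * ‖(z.1 : ℂ) - β i * z.2‖))) :
    S.card * Real.log G ≤ 42 * Real.log G + 34 := by
  obtain ⟨hb, hc, hd, he⟩ := quartic_coeff_bounds hfac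
  refine card_mul_le_of_solutions hdeg (fun i => ?_) hb hc hd he (fun i => ?_) hβ
    norm_vandermonde_le_prod_erase hG hβG hS0 hScop hS hSG
  · rw [hfac, Finset.prod_eq_zero (Finset.mem_univ i) (sub_self _)]
  · rw [← Finset.prod_singleton (fun i => 1 + ‖β i‖) i]
    exact Finset.prod_le_prod_of_subset_of_one_le (Finset.subset_univ _)
      (fun _ _ => by positivity) fun _ _ _ => by linarith [norm_nonneg (β ‹_›)]

theorem quartic_vieta {a b c d e : ℂ} {α : Fin 4 → ℂ}
    (hfac : ∀ X : ℂ, a * X ^ 4 + b * X ^ 3 + c * X ^ 2 + d * X + e = a * ∏ i, (X - α i)) :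
    b = -(a * (α 0 + α 1 + α 2 + α 3)) ∧
    c = a * (α 0 * α 1 + α 0 * α 2 + α 0 * α 3 + α 1 * α 2 + α 1 * α 3 + α 2 * α 3) ∧
    d = -(a * (α 0 * α 1 * α 2 + α 0 * α 1 * α 3 + α 0 * α 2 * α 3 + α 1 * α 2 * α 3)) ∧
    e = a * (α 0 * α 1 * α 2 * α 3) := by
  simp only [Fin.prod_univ_four] at hfac
  have h0 := hfac 0
  have h1 := hfac 1
  have h2 := hfac (-1)
  have h3 := hfac 2
  refine ⟨?_, ?_, ?_, ?_⟩
  · linear_combination (h3 - h0 - 4 * ((h1 + h2) / 2 - h0) - (h1 - h2)) / 6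
  · linear_combination (h1 + h2) / 2 - h0
  · linear_combination (h1 - h2) / 2 - (h3 - h0 - 4 * ((h1 + h2) / 2 - h0) - (h1 - h2)) / 6
  · linear_combination h0

theorem exists_eq_C_mul_prod_X_sub_C {p : ℂ[X]} {n : ℕ} (hn : p.natDegree = n) :
    ∃ α : Fin n → ℂ, p = C p.leadingCoeff * ∏ i, (X - C (α i)) := by
  have hp := IsAlgClosed.splits p
  have hcard : p.roots.toList.length = n := by
    rw [Multiset.length_toList, ← hn, hp.natDegree_eq_card_roots]
  subst hcard
  refine ⟨fun i => p.roots.toList[i.1], ?_⟩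
  rw [Fin.prod_univ_fun_getElem p.roots.toList fun r => X - C r, ← Multiset.prod_coe,
    ← Multiset.map_coe, Multiset.coe_toList]
  exact hp.eq_prod_roots

theorem quartic_eq_mul_prod {a b c d e : ℂ} {α : Fin 4 → ℂ}
    (hfac : ∀ X : ℂ, a * X ^ 4 + b * X ^ 3 + c * X ^ 2 + d * X + e = a * ∏ i, (X - α i)) (X Y : ℂ) :
    a * X ^ 4 + b * X ^ 3 * Y + c * X ^ 2 * Y ^ 2 + d * X * Y ^ 3 + e * Y ^ 4 =
      a * ∏ i, (X - α i * Y) := by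
  obtain ⟨rfl, rfl, rfl, rfl⟩ := quartic_vieta hfac
  rw [Fin.prod_univ_four]
  ring

theorem quarticDisc_eq_mul_sq {a b c d e : ℤ} {α : Fin 4 → ℂ} (hfac : ∀ X : ℂ,
    a * X ^ 4 + b * X ^ 3 + c * X ^ 2 + d * X + e = a * ∏ i, (X - α i)) :
    (quarticDisc a b c d e : ℂ) = a ^ 6 * ((α 0 - α 1) * (α 0 - α 2) * (α 0 - α 3) *
      (α 1 - α 2) * (α 1 - α 3) * (α 2 - α 3)) ^ 2 := by
  obtain ⟨hb, hc, hd, he⟩ := quartic_vieta hfac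
  rw [quarticDisc]
  push_cast
  rw [hb, hc, hd, he]
  ring

open IntermediateField in
theorem natDegree_minpoly_neg_div {α : ℂ} {x y u v : ℤ} (h : x * v - y * u = 1)
    (hα : (x : ℂ) - α * y ≠ 0) (hi : IsIntegral ℚ α) :
    (minpoly ℚ (-((u - α * v) / (x - α * y)))).natDegree = (minpoly ℚ α).natDegree := by
  set β := -((u - α * v) / (x - α * y)) with hβ
  have h' : (x : ℂ) * v - y * u = 1 := by exact_mod_cast h
  have hβα : β * (x - α * y) = -(u - α * v) := by rw [hβ, neg_mul, div_mul_cancel₀ _ hα]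
  have hvy : (v : ℂ) + β * y ≠ 0 := fun h0 => by
    have : (β * x + u : ℂ) = 0 := by linear_combination hβα + α * h0
    have : (1 : ℂ) = 0 := by linear_combination x * h0 - y * this - h'
    exact one_ne_zero this
  have hαβ : α = (β * x + u) / (v + β * y) := by
    rw [eq_div_iff hvy]
    linear_combination -hβα
  have hβmem : β ∈ ℚ⟮α⟯ := by
    have hm := mem_adjoin_simple_self ℚ α
    exact neg_mem (div_mem (sub_mem (intCast_mem _ _) (mul_mem hm (intCast_mem _ _)))
      (sub_mem (intCast_mem _ _) (mul_mem hm (intCast_mem _ _))))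
  have hαmem : α ∈ ℚ⟮β⟯ := by
    have hm := mem_adjoin_simple_self ℚ β
    rw [hαβ]
    exact div_mem (add_mem (mul_mem hm (intCast_mem _ _)) (intCast_mem _ _))
      (add_mem (intCast_mem _ _) (mul_mem hm (intCast_mem _ _)))
  have hiβ : IsIntegral ℚ β := by
    have hd : IsIntegral ℚ ((x : ℂ) - α * y)⁻¹ :=
      IsIntegral.inv ((isIntegral_intCast _).sub (hi.mul (isIntegral_intCast _)))
    rw [hβ, div_eq_mul_inv]
    exact ((((isIntegral_intCast _).sub (hi.mul (isIntegral_intCast _)))).mul hd).neg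
  have heq : ℚ⟮β⟯ = ℚ⟮α⟯ :=
    le_antisymm (adjoin_simple_le_iff.2 hβmem) (adjoin_simple_le_iff.2 hαmem)
  rw [← adjoin.finrank hi, ← adjoin.finrank hiβ, heq]

theorem vandermonde_div_sq {a x y w₁ w₂ : ℂ} {α : Fin 4 → ℂ} (hw : x * w₂ - y * w₁ = 1)
    (ha : (a * ∏ i, (x - α i * y)) ^ 2 = 1) {ω : Fin 4 → ℂ}
    (hω : ∀ i, ω i = (w₁ - α i * w₂) / (x - α i * y)) :
    a ^ 6 * ((α 0 - α 1) * (α 0 - α 2) * (α 0 - α 3) * (α 1 - α 2) * (α 1 - α 3) *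
      (α 2 - α 3)) ^ 2 =
    ((ω 0 - ω 1) * (ω 0 - ω 2) * (ω 0 - ω 3) * (ω 1 - ω 2) * (ω 1 - ω 3) * (ω 2 - ω 3)) ^ 2 := by
  have hne : ∀ i, x - α i * y ≠ 0 := fun i h => by
    rw [Finset.prod_eq_zero (Finset.mem_univ i) h] at ha
    simp at ha
  have hsub : ∀ i j, α i - α j = -(ω i - ω j) * ((x - α i * y) * (x - α j * y)) := fun i j => by
    have hi := (eq_div_iff (hne i)).1 (hω i)
    have hj := (eq_div_iff (hne j)).1 (hω j)
    linear_combination (x - α j * y) * hi - (x - α i * y) * hj - (α i - α j) * hw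
  have hprod : (α 0 - α 1) * (α 0 - α 2) * (α 0 - α 3) * (α 1 - α 2) * (α 1 - α 3) * (α 2 - α 3) =
      (ω 0 - ω 1) * (ω 0 - ω 2) * (ω 0 - ω 3) * (ω 1 - ω 2) * (ω 1 - ω 3) * (ω 2 - ω 3) *
        (∏ i, (x - α i * y)) ^ 3 := by
    rw [hsub 0 1, hsub 0 2, hsub 0 3, hsub 1 2, hsub 1 3, hsub 2 3, Fin.prod_univ_four]
    generalize x - α 0 * y = l₀, x - α 1 * y = l₁, x - α 2 * y = l₂, x - α 3 * y = l₃,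
      ω 0 - ω 1 = d₀₁, ω 0 - ω 2 = d₀₂, ω 0 - ω 3 = d₀₃, ω 1 - ω 2 = d₁₂, ω 1 - ω 3 = d₁₃,
      ω 2 - ω 3 = d₂₃
    ring
  rw [hprod, mul_pow, ← pow_mul, mul_left_comm, ← mul_pow,
    show (a * ∏ i, (x - α i * y)) ^ 6 = ((a * ∏ i, (x - α i * y)) ^ 2) ^ 3 by ring, ha, one_pow,
    mul_one]

/-- The size of a unimodular completion `(w₁, w₂)` of `(x, y)`, measured by the linear factors
`X - α i * Y` and truncated from below. -/
noncomputable def completionSize (α : Fin 4 → ℂ) (x y : ℤ) (w₁ w₂ : ℝ) : ℝ :=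
  ∏ i, max 1 (‖((w₁ : ℂ) - α i * w₂) / (x - α i * y)‖ / 2)

theorem one_le_completionSize (α : Fin 4 → ℂ) (x y : ℤ) (w₁ w₂ : ℝ) :
    1 ≤ completionSize α x y w₁ w₂ :=
  Finset.one_le_prod fun _ _ => le_max_left _ _

theorem norm_disc_le_completionSize {a : ℂ} {x y : ℤ} {w₁ w₂ : ℝ} {α : Fin 4 → ℂ}
    (hw : x * w₂ - y * w₁ = 1) (ha : (a * ∏ i, ((x : ℂ) - α i * y)) ^ 2 = 1) :
    ‖a ^ 6 * ((α 0 - α 1) * (α 0 - α 2) * (α 0 - α 3) * (α 1 - α 2) * (α 1 - α 3) *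
      (α 2 - α 3)) ^ 2‖ ≤ 2 ^ 24 * completionSize α x y w₁ w₂ ^ 6 := by
  have hw' : (x : ℂ) * w₂ - y * w₁ = 1 := by exact_mod_cast congrArg Complex.ofReal hw
  rw [vandermonde_div_sq hw' ha fun i => rfl, norm_pow]
  calc _ ≤ (4 ^ 6 * completionSize α x y w₁ w₂ ^ 3) ^ 2 := by
        gcongr
        refine norm_vandermonde_le (z := fun i => ((w₁ : ℂ) - α i * w₂) / (x - α i * y))
          (by norm_num) (fun i => le_max_left _ _) fun i j => ?_
        refine (norm_sub_le _ _).trans ?_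
        set m := fun i => max 1 (‖((w₁ : ℂ) - α i * w₂) / (x - α i * y)‖ / 2)
        have h1 : ∀ i, 1 ≤ m i := fun i => le_max_left _ _
        have h2 : ∀ i, ‖((w₁ : ℂ) - α i * w₂) / (x - α i * y)‖ ≤ 2 * m i := fun i => by
          linarith [le_max_right 1 (‖((w₁ : ℂ) - α i * w₂) / (x - α i * y)‖ / 2)]
        change _ ≤ 4 * (m i * m j)
        nlinarith [h1 i, h1 j, h2 i, h2 j, mul_nonneg (sub_nonneg.2 (h1 i)) (sub_nonneg.2 (h1 j))]
    _ = _ := by ring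

theorem exists_reduced_completion {α : Fin 4 → ℂ} {P : ℤ → ℤ → Prop}
    (hP : ∀ x y, P x y → IsCoprime x y) (hne : ∀ x y, P x y → ∀ i, (x : ℂ) - α i * y ≠ 0)
    (hex : ∃ x y, P x y) :
    ∃ G : ℝ, 1 ≤ G ∧
      (∀ (x y : ℤ) (w₁ w₂ : ℝ), P x y → x * w₂ - y * w₁ = 1 → G ≤ completionSize α x y w₁ w₂) ∧
      (∀ m, (∀ (x y : ℤ) (w₁ w₂ : ℝ), P x y → x * w₂ - y * w₁ = 1 →
        m ≤ completionSize α x y w₁ w₂) → m ≤ G) ∧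
      ∃ x y u v : ℤ, P x y ∧ x * v - y * u = 1 ∧
        ∏ i, (1 + ‖((u : ℂ) - α i * v) / (x - α i * y)‖) ≤ 152 * G := by
  set s : Set ℝ := {r | ∃ (x y : ℤ) (w₁ w₂ : ℝ), P x y ∧ x * w₂ - y * w₁ = 1 ∧
    r = completionSize α x y w₁ w₂}
  have hs1 : ∀ r ∈ s, 1 ≤ r := by
    rintro r ⟨x, y, w₁, w₂, -, -, rfl⟩
    exact one_le_completionSize _ _ _ _ _
  have hs : s.Nonempty := by
    obtain ⟨x, y, h⟩ := hex
    obtain ⟨p, q, hpq⟩ := hP x y h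
    exact ⟨_, x, y, -q, p, h, by push_cast [← @Int.cast_inj ℝ] at hpq; linarith, rfl⟩
  have hG : 1 ≤ sInf s := le_csInf hs hs1
  obtain ⟨r, ⟨x, y, w₁, w₂, hxy, hw, rfl⟩, hr⟩ :=
    exists_lt_of_csInf_lt hs (show sInf s < 1.01 * sInf s by linarith)
  refine ⟨sInf s, hG, fun x y w₁ w₂ h h' => csInf_le ⟨1, hs1⟩ ⟨x, y, w₁, w₂, h, h', rfl⟩,
    fun m hm => le_csInf hs ?_, ?_⟩
  · rintro r ⟨x, y, w₁, w₂, h, h', rfl⟩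
    exact hm x y w₁ w₂ h h'
  obtain ⟨p, q, hpq⟩ := hP x y hxy
  set t : ℝ := w₁ * p + w₂ * q with ht
  refine ⟨x, y, -q + round t * x, p + round t * y, hxy, by linear_combination hpq, ?_⟩
  have hpq' : (p : ℝ) * x + q * y = 1 := by exact_mod_cast hpq
  have hw1 : w₁ = -q + t * x := by rw [ht]; linear_combination (-w₁) * hpq' - q * hw
  have hw2 : w₂ = p + t * y := by rw [ht]; linear_combination (-w₂) * hpq' + p * hw
  have hρ : ∀ i, 1 + ‖(((-q + round t * x : ℤ) : ℂ) - α i * (p + round t * y : ℤ)) / (x - α i * y)‖ ≤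
      7 / 2 * max 1 (‖((w₁ : ℂ) - α i * w₂) / (x - α i * y)‖ / 2) := fun i => by
    have heq : (((-q + round t * x : ℤ) : ℂ) - α i * (p + round t * y : ℤ)) / (x - α i * y) =
        ((w₁ : ℂ) - α i * w₂) / (x - α i * y) + ((round t - t : ℝ) : ℂ) := by
      rw [div_add' _ _ _ (hne x y hxy i), hw1, hw2]
      push_cast
      ring
    have h1 : ‖((round t - t : ℝ) : ℂ)‖ ≤ 1 / 2 := by
      rw [Complex.norm_real, Real.norm_eq_abs, abs_sub_comm]
      exact abs_sub_round t
    rw [heq]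
    have h2 := norm_add_le (((w₁ : ℂ) - α i * w₂) / (x - α i * y)) ((round t - t : ℝ) : ℂ)
    have h3 := le_max_left 1 (‖((w₁ : ℂ) - α i * w₂) / (x - α i * y)‖ / 2)
    have h4 := le_max_right 1 (‖((w₁ : ℂ) - α i * w₂) / (x - α i * y)‖ / 2)
    linarith
  calc _ ≤ ∏ i, 7 / 2 * max 1 (‖((w₁ : ℂ) - α i * w₂) / (x - α i * y)‖ / 2) :=
        Finset.prod_le_prod (fun _ _ => by positivity) fun i _ => hρ i
    _ = (7 / 2) ^ 4 * completionSize α x y w₁ w₂ := by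
        rw [Finset.prod_mul_distrib]
        rw [Finset.prod_const, Finset.card_univ, Fintype.card_fin, completionSize]
    _ ≤ (7 / 2) ^ 4 * (1.01 * sInf s) := by gcongr
    _ ≤ 152 * sInf s := by linarith

theorem natDegree_quarticPoly {a : ℤ} (ha : a ≠ 0) (b c d e : ℤ) :
    (quarticPoly a b c d e).natDegree = 4 := by
  have ha' : (a : ℚ) ≠ 0 := by exact_mod_cast ha
  unfold quarticPoly
  compute_degree!

theorem aeval_quarticPoly (a b c d e : ℤ) (x : ℂ) :
    aeval x (quarticPoly a b c d e) = a * x ^ 4 + b * x ^ 3 + c * x ^ 2 + d * x + e := by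
  simp [quarticPoly]

theorem exists_quartic_roots {a : ℤ} (ha : a ≠ 0) (b c d e : ℤ) : ∃ α : Fin 4 → ℂ, ∀ x : ℂ,
    a * x ^ 4 + b * x ^ 3 + c * x ^ 2 + d * x + e = a * ∏ i, (x - α i) := by
  have hdeg := natDegree_quarticPoly ha b c d e
  obtain ⟨α, hα⟩ := exists_eq_C_mul_prod_X_sub_C
    (p := (quarticPoly a b c d e).map (algebraMap ℚ ℂ)) (n := 4) (by rw [natDegree_map, hdeg])
  refine ⟨α, fun x => ?_⟩
  have hlead : (quarticPoly a b c d e).leadingCoeff = a := by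
    rw [leadingCoeff, hdeg]
    simp only [quarticPoly, coeff_add, coeff_C_mul, coeff_X_pow, coeff_X, coeff_C]
    norm_num
  rw [← aeval_quarticPoly, ← eval_map_algebraMap, hα, leadingCoeff_map, hlead]
  simp [eval_prod]

theorem natDegree_minpoly_of_quartic {a b c d e : ℤ} (ha : a ≠ 0)
    (hirr : Irreducible (quarticPoly a b c d e)) {x : ℂ}
    (hx : a * x ^ 4 + b * x ^ 3 + c * x ^ 2 + d * x + e = 0) :
    IsIntegral ℚ x ∧ (minpoly ℚ x).natDegree = 4 := by
  rw [← aeval_quarticPoly] at hx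
  refine ⟨IsAlgebraic.isIntegral ⟨_, hirr.ne_zero, hx⟩, ?_⟩
  rw [← minpoly.eq_of_irreducible hirr hx, natDegree_mul_C (by simpa using hirr.ne_zero),
    natDegree_quarticPoly ha]

theorem isCoprime_of_abs_quarticEval_eq_one {a b c d e x y : ℤ}
    (h : |quarticEval a b c d e x y| = 1) : IsCoprime x y := by
  have h2 : quarticEval a b c d e x y ^ 2 = 1 := by rw [← sq_abs, h, one_pow]
  refine ⟨quarticEval a b c d e x y * (a * x ^ 3 + b * x ^ 2 * y + c * x * y ^ 2 + d * y ^ 3),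
    quarticEval a b c d e x y * (e * y ^ 3), ?_⟩
  rw [← h2]
  unfold quarticEval
  ring

theorem quarticEval_cast (a b c d e x y : ℤ) : (quarticEval a b c d e x y : ℂ) =
    a * x ^ 4 + b * x ^ 3 * y + c * x ^ 2 * y ^ 2 + d * x * y ^ 3 + e * y ^ 4 := by
  rw [quarticEval]
  push_cast
  rfl

theorem exists_quartic_comp (a b c d e x y u v : ℤ) : ∃ b' c' d' e' : ℤ, ∀ X : ℂ,
    a * (x * X + u) ^ 4 + b * (x * X + u) ^ 3 * (y * X + v) +
      c * (x * X + u) ^ 2 * (y * X + v) ^ 2 + d * (x * X + u) * (y * X + v) ^ 3 +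
      e * (y * X + v) ^ 4 =
    quarticEval a b c d e x y * X ^ 4 + b' * X ^ 3 + c' * X ^ 2 + d' * X + e' := by
  refine ⟨4 * a * x ^ 3 * u + b * (3 * x ^ 2 * u * y + x ^ 3 * v) +
      c * (2 * x * u * y ^ 2 + 2 * x ^ 2 * y * v) + d * (u * y ^ 3 + 3 * x * y ^ 2 * v) +
      4 * e * y ^ 3 * v,
    6 * a * x ^ 2 * u ^ 2 + b * (3 * x * u ^ 2 * y + 3 * x ^ 2 * u * v) +
      c * (u ^ 2 * y ^ 2 + 4 * x * u * y * v + x ^ 2 * v ^ 2) +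
      d * (3 * u * y ^ 2 * v + 3 * x * y * v ^ 2) + 6 * e * y ^ 2 * v ^ 2,
    4 * a * u ^ 3 * x + b * (3 * u ^ 2 * x * v + u ^ 3 * y) +
      c * (2 * u * x * v ^ 2 + 2 * u ^ 2 * v * y) + d * (x * v ^ 3 + 3 * u * v ^ 2 * y) +
      4 * e * v ^ 3 * y,
    quarticEval a b c d e u v, fun X => ?_⟩
  rw [quarticEval_cast, quarticEval_cast]
  push_cast
  ring

theorem Set.exists_finset_card_le_of_forall {α : Type*} {s : Set α} {n : ℕ}
    (h : ∀ t : Finset α, ↑t ⊆ s → t.card ≤ n) :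
    ∃ t : Finset α, (∀ x, x ∈ t ↔ x ∈ s) ∧ t.card ≤ n := by
  have hs : s.Finite := by
    by_contra hs
    obtain ⟨t, ht, hc⟩ := Set.Infinite.exists_subset_card_eq hs (n + 1)
    have := h t ht
    omega
  exact ⟨hs.toFinset, fun x => hs.mem_toFinset, h _ (by simp)⟩

theorem card_add_one_le_of_log {κ D G n : ℝ} (hκ0 : 0 < κ) (hκ1 : κ < 1)
    (hD : ((7/2 : ℝ) ^ 12 * 4 ^ 4) ^ ((1 : ℝ)/(1 - κ)) < D) (hG : 0 < G)
    (hDG : D ≤ 2 ^ 24 * G ^ 6) (hn : n * Real.log G ≤ 42 * Real.log G + 34) :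
    n + 1 ≤ 36 + 8 / κ := by
  have hκ : 0 < 1 - κ := by linarith
  have hL : 89 * Real.log 2 ≤ 3 * Real.log ((7/2 : ℝ) ^ 12 * 4 ^ 4) := by
    rw [← Nat.cast_ofNat (n := 89), ← Nat.cast_ofNat (n := 3), ← Real.log_pow, ← Real.log_pow]
    exact Real.log_le_log (by norm_num) (by norm_num)
  have hlt := (Real.log_lt_log (by positivity) hD).le.trans
    (Real.log_le_log ((by positivity : (0 : ℝ) < _).trans hD) hDG)
  have hlog : Real.log (2 ^ 24 * G ^ 6) = 24 * Real.log 2 + 6 * Real.log G := by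
    rw [Real.log_mul (by norm_num) (by positivity), Real.log_pow, Real.log_pow]
    norm_num
  rw [Real.log_rpow (by norm_num), hlog, one_div_mul_eq_div, div_le_iff₀ hκ] at hlt
  have hl2 := Real.log_two_gt_d9
  by_contra! hlt'
  have h1 : 8 - 7 * κ < (n - 42) * κ := by
    have h := mul_lt_mul_of_pos_right hlt' hκ0
    rw [add_mul, div_mul_cancel₀ _ hκ0.ne'] at h
    linarith
  have h2 : 0.6931 * (17 / 3 + 24 * κ) ≤ 6 * Real.log G * (1 - κ) := by
    nlinarith [mul_le_mul_of_nonneg_right hl2.le (by positivity : 0 ≤ 17 / 3 + 24 * κ)]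
  have h3 : (n - 42) * Real.log G ≤ 34 := by linarith
  have h4 : (8 - 7 * κ) * (0.6931 * (17 / 3 + 24 * κ)) ≤
      ((n - 42) * κ) * (6 * Real.log G * (1 - κ)) :=
    mul_le_mul h1.le h2 (by positivity) (by linarith)
  nlinarith [mul_le_mul_of_nonneg_left h3 (mul_nonneg hκ0.le hκ.le), sq_nonneg (κ - 0.5)]

theorem norm_sub_mul_prod_eq_one {a b c d e : ℤ} {α : Fin 4 → ℂ} (hfac : ∀ x : ℂ,
    a * x ^ 4 + b * x ^ 3 + c * x ^ 2 + d * x + e = a * ∏ i, (x - α i)) {x y : ℤ}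
    (h : |quarticEval a b c d e x y| = 1) : (a * ∏ i, ((x : ℂ) - α i * y)) ^ 2 = 1 := by
  rw [← quartic_eq_mul_prod hfac, ← quarticEval_cast, ← Int.cast_pow, ← sq_abs, h]
  simp

theorem exists_finset_quartic_solutions {a b c d e : ℤ} {α : Fin 4 → ℂ} {x y u v n : ℤ}
    (hfac : ∀ x : ℂ, a * x ^ 4 + b * x ^ 3 + c * x ^ 2 + d * x + e = a * ∏ i, (x - α i))
    (hdeg : ∀ i, (minpoly ℚ (α i)).natDegree = 4) (hint : ∀ i, IsIntegral ℚ (α i))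
    (hxy : |quarticEval a b c d e x y| = 1) (huv : x * v - y * u = 1)
    (hD : 29000 ^ 2 ≤ |(quarticDisc a b c d e : ℝ)|) {G : ℝ} (hG : 1 ≤ G)
    (hQG : ∏ i, (1 + ‖((u : ℂ) - α i * v) / (x - α i * y)‖) ≤ 152 * G)
    (hmin : ∀ (x y : ℤ) (w₁ w₂ : ℝ), |quarticEval a b c d e x y| = 1 → x * w₂ - y * w₁ = 1 →
      G ≤ completionSize α x y w₁ w₂)
    (hn : ∀ k : ℕ, k * Real.log G ≤ 42 * Real.log G + 34 → k ≤ n) :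
    ∃ S : Finset (ℤ × ℤ), (S.card : ℤ) ≤ n + 1 ∧
      ∀ x y : ℤ, |quarticEval a b c d e x y| = 1 → (x, y) ∈ S ∨ (-x, -y) ∈ S := by
  classical
  have hx2 := norm_sub_mul_prod_eq_one hfac hxy
  have hne : ∀ i, (x : ℂ) - α i * y ≠ 0 := fun i h => by
    rw [Finset.prod_eq_zero (Finset.mem_univ i) h] at hx2
    simp at hx2
  obtain ⟨β, hβ⟩ : ∃ β : Fin 4 → ℂ, ∀ i, β i = -(((u : ℂ) - α i * v) / (x - α i * y)) :=
    ⟨_, fun _ => rfl⟩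
  have hlin : ∀ i (X Y : ℂ), (x * X + u * Y) - α i * (y * X + v * Y) =
      (x - α i * y) * (X - β i * Y) := fun i X Y => by
    have : β i * (x - α i * y) = -(u - α i * v) := by
      rw [hβ, neg_mul, div_mul_cancel₀ _ (hne i)]
    linear_combination Y * this
  have hcomp : ∀ X Y : ℂ, a * ∏ i, ((x * X + u * Y) - α i * (y * X + v * Y)) =
      quarticEval a b c d e x y * ∏ i, (X - β i * Y) := fun X Y => by
    rw [quarticEval_cast, quartic_eq_mul_prod hfac]
    simp only [hlin, Finset.prod_mul_distrib]
    ring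
  have hε : (quarticEval a b c d e x y : ℂ) * quarticEval a b c d e x y = 1 := by
    have : quarticEval a b c d e x y * quarticEval a b c d e x y = 1 := by
      rw [← abs_mul_abs_self, hxy, one_mul]
    exact_mod_cast this
  obtain ⟨b', c', d', e', hexp⟩ := exists_quartic_comp a b c d e x y u v
  set ε := quarticEval a b c d e x y
  have hfac' : ∀ X : ℂ, X ^ 4 + (ε * b' : ℤ) * X ^ 3 + (ε * c' : ℤ) * X ^ 2 + (ε * d' : ℤ) * X +
      (ε * e' : ℤ) = ∏ i, (X - β i) := fun X => by
    have h1 := hcomp X 1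
    have h2 := hexp X
    rw [quartic_eq_mul_prod hfac] at h2
    simp only [mul_one] at h1
    rw [h1] at h2
    push_cast
    linear_combination (∏ i, (X - β i) - X ^ 4) * hε - ε * h2
  have hdisc : ‖(β 0 - β 1) * (β 0 - β 2) * (β 0 - β 3) * (β 1 - β 2) * (β 1 - β 3) *
      (β 2 - β 3)‖ ^ 2 = |(quarticDisc a b c d e : ℝ)| := by
    rw [← Complex.norm_intCast, quarticDisc_eq_mul_sq hfac,
      vandermonde_div_sq (x := x) (y := y) (w₁ := u) (w₂ := v) (ω := fun i => -β i)
        (by exact_mod_cast huv) hx2 fun i => by rw [hβ, neg_neg], ← norm_pow]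
    congr 1
    ring
  set φ : ℤ × ℤ → ℤ × ℤ := fun z => (x * z.1 + u * z.2, y * z.1 + v * z.2)
  set T : Set (ℤ × ℤ) := {z | 0 < z.2 ∧ |quarticEval a b c d e (φ z).1 (φ z).2| = 1}
  obtain ⟨N, hN⟩ : ∃ N : ℕ, (N : ℤ) = max n 0 := ⟨(max n 0).toNat, by simp⟩
  obtain ⟨S, hST, hSN⟩ := Set.exists_finset_card_le_of_forall (s := T) (n := N) fun S hS => by
    have hlinz : ∀ (i) (z : ℤ × ℤ), ((φ z).1 : ℂ) - α i * (φ z).2 =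
        (x - α i * y) * (z.1 - β i * z.2) := fun i z => by
      rw [← hlin]
      simp [φ]
    have hsol : ∀ z ∈ S, ∏ i, ‖(z.1 : ℂ) - β i * z.2‖ = 1 := fun z hz => by
      have h1 := norm_sub_mul_prod_eq_one hfac (hS hz).2
      simp only [hlinz, Finset.prod_mul_distrib] at h1
      rw [← mul_assoc, mul_pow, hx2, one_mul] at h1
      rw [← norm_prod]
      refine (pow_eq_one_iff_of_nonneg (norm_nonneg _) two_ne_zero).1 ?_
      rw [← norm_pow, h1, norm_one]
    suffices h : (S.card : ℝ) * Real.log G ≤ 42 * Real.log G + 34 by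
      have := hn _ h
      omega
    refine card_mul_le_of_monic (β := β) (fun i => ?_) hfac' ?_ hG ?_ (fun z hz => (hS hz).1)
      (fun z hz => ?_) hsol fun z hz => ?_
    · rw [hβ, natDegree_minpoly_neg_div huv (hne i) (hint i), hdeg]
    · exact (sq_le_sq₀ (by norm_num) (norm_nonneg _)).1 (hD.trans hdisc.ge)
    · simpa only [hβ, norm_neg] using hQG
    · obtain ⟨p, q, hpq⟩ := isCoprime_of_abs_quarticEval_eq_one (hS hz).2
      exact ⟨p * x + q * y, p * u + q * v, by rw [← hpq]; ring⟩
    · have hz0 : (0 : ℝ) < z.2 := by exact_mod_cast (hS hz).1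
      have huv' : (x : ℝ) * v - y * u = 1 := by exact_mod_cast huv
      refine (hmin _ _ (-x / z.2) (-y / z.2) (hS hz).2 ?_).trans_eq ?_
      · simp only [φ]
        push_cast
        field_simp
        linear_combination z.2 * huv'
      · refine Finset.prod_congr rfl fun i _ => ?_
        rw [hlinz]
        congr 1
        have : (((-x / z.2 : ℝ) : ℂ) - α i * (-y / z.2 : ℝ)) = -(x - α i * y) / z.2 := by
          push_cast
          ring
        rw [this, neg_div, neg_div, norm_neg, div_div, norm_div, norm_mul, norm_mul,
          Complex.norm_intCast, abs_of_pos hz0]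
        rw [mul_comm (z.2 : ℝ), ← div_div, ← div_div, div_self (norm_ne_zero_iff.2 (hne i))]
        ring
  have hn0 : 0 ≤ n := hn 0 (by
    have := Real.log_nonneg hG
    push_cast
    linarith)
  refine ⟨insert (x, y) (S.image φ), ?_, fun x₁ y₁ h₁ => ?_⟩
  · have h1 := Finset.card_insert_le (x, y) (S.image φ)
    have h2 := Finset.card_image_le (s := S) (f := φ)
    omega
  · have hneg : ∀ p q : ℤ, quarticEval a b c d e (-p) (-q) = quarticEval a b c d e p q :=
      fun p q => by unfold quarticEval; ring
    have hφ : φ (x₁ * v - y₁ * u, x * y₁ - y * x₁) = (x₁, y₁) :=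
      Prod.ext (by linear_combination x₁ * huv) (by linear_combination y₁ * huv)
    have hφ' : φ (-(x₁ * v - y₁ * u), -(x * y₁ - y * x₁)) = (-x₁, -y₁) :=
      Prod.ext (by linear_combination -x₁ * huv) (by linear_combination -y₁ * huv)
    rcases lt_trichotomy 0 (x * y₁ - y * x₁) with hY | hY | hY
    · refine .inl (Finset.mem_insert_of_mem (Finset.mem_image.2 ⟨_, (hST _).2 ⟨hY, ?_⟩, hφ⟩))
      rwa [hφ]
    · obtain ⟨p, q, hpq⟩ := isCoprime_of_abs_quarticEval_eq_one h₁
      have hunit : (x₁ * v - y₁ * u) * (p * x + q * y) = 1 := by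
        linear_combination hpq + (p * x₁ + q * y₁) * huv + (q * v + p * u) * hY
      have hx₁ : x₁ = (x₁ * v - y₁ * u) * x := by linear_combination -x₁ * huv - u * hY
      have hy₁ : y₁ = (x₁ * v - y₁ * u) * y := by linear_combination -y₁ * huv - v * hY
      rcases Int.isUnit_iff.1 (.of_mul_eq_one _ hunit) with h | h <;> rw [h] at hx₁ hy₁
      · exact .inl (by simp [hx₁, hy₁])
      · exact .inr (by simp [hx₁, hy₁])
    · refine .inr (Finset.mem_insert_of_mem (Finset.mem_image.2 ⟨_, (hST _).2 ⟨by simpa using hY, ?_⟩,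
        hφ'⟩))
      rw [hφ', hneg, h₁]

end

/-- Akhtari's bound: if `f` is an irreducible integral binary quartic form with
`|Disc(f)| > D₁^{1/(1-κ)}` where `D₁ = (7/2)¹²·4⁴` and `0 < κ < 1`, then `|f(x,y)| = 1`
has at most `⌊36 + 8/κ⌋` integer solutions, with `(x,y) ∼ (-x,-y)` identified. -/
theorem quartic_thue_bound_in_kappa (a b c d e : ℤ)
    (ha : a ≠ 0) (hirr : Irreducible (quarticPoly a b c d e))
    (κ : ℝ) (hκ0 : 0 < κ) (hκ1 : κ < 1)
    (hD : ((7/2 : ℝ) ^ 12 * 4 ^ 4) ^ ((1 : ℝ)/(1 - κ)) < |(quarticDisc a b c d e : ℝ)|) :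
    ∃ S : Finset (ℤ × ℤ), (S.card : ℤ) ≤ ⌊(36 : ℝ) + 8/κ⌋ ∧
      ∀ x y : ℤ, |quarticEval a b c d e x y| = 1 → (x, y) ∈ S ∨ (-x, -y) ∈ S := by
  by_cases hex : ∃ x y, |quarticEval a b c d e x y| = 1
  swap
  · push Not at hex
    exact ⟨∅, by rw [Finset.card_empty]; exact Int.floor_nonneg.2 (by positivity),
      fun x y h => absurd h (hex x y)⟩
  obtain ⟨α, hfac⟩ := exists_quartic_roots ha b c d e
  have hα : ∀ i, IsIntegral ℚ (α i) ∧ (minpoly ℚ (α i)).natDegree = 4 := fun i =>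
    natDegree_minpoly_of_quartic ha hirr <| by
      rw [hfac, Finset.prod_eq_zero (Finset.mem_univ i) (sub_self _), mul_zero]
  obtain ⟨G, hG, hmin, hglb, x, y, u, v, hxy, huv, hQG⟩ :=
    exists_reduced_completion (α := α) (P := fun x y => |quarticEval a b c d e x y| = 1)
      (fun x y h => isCoprime_of_abs_quarticEval_eq_one h) (fun x y h i h0 => by
        have h2 := norm_sub_mul_prod_eq_one hfac h
        rw [Finset.prod_eq_zero (Finset.mem_univ i) h0] at h2
        simp at h2) hex
  have hD0 : 0 ≤ |(quarticDisc a b c d e : ℝ)| / 2 ^ 24 := by positivity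
  have hDG : |(quarticDisc a b c d e : ℝ)| ≤ 2 ^ 24 * G ^ 6 := by
    have h := hglb ((|(quarticDisc a b c d e : ℝ)| / 2 ^ 24) ^ ((6 : ℕ) : ℝ)⁻¹)
      fun x y w₁ w₂ h hw => by
        refine (pow_le_pow_iff_left₀ (by positivity)
          (zero_le_one.trans (one_le_completionSize _ _ _ _ _)) (by norm_num : (6 : ℕ) ≠ 0)).1 ?_
        rw [Real.rpow_inv_natCast_pow hD0 (by norm_num), div_le_iff₀' (by positivity),
          ← Complex.norm_intCast, quarticDisc_eq_mul_sq hfac]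
        exact norm_disc_le_completionSize hw (norm_sub_mul_prod_eq_one hfac h)
    have h6 := pow_le_pow_left₀ (by positivity) h 6
    rwa [Real.rpow_inv_natCast_pow hD0 (by norm_num), div_le_iff₀' (by positivity)] at h6
  have hD1 : (29000 : ℝ) ^ 2 ≤ |(quarticDisc a b c d e : ℝ)| := by
    refine le_trans ?_ hD.le
    refine le_trans ?_ (Real.rpow_le_rpow_of_exponent_le (by norm_num)
      ((one_le_div (by linarith)).2 (by linarith) : 1 ≤ 1 / (1 - κ)))
    norm_num
  obtain ⟨S, hS, hsol⟩ := exists_finset_quartic_solutions (n := ⌊(36 : ℝ) + 8/κ⌋ - 1) hfac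
    (fun i => (hα i).2) (fun i => (hα i).1) hxy huv hD1 hG hQG hmin fun k hk => by
      have h := card_add_one_le_of_log hκ0 hκ1 hD (by linarith) hDG hk
      have : (k + 1 : ℤ) ≤ ⌊(36 : ℝ) + 8/κ⌋ := Int.le_floor.2 (by exact_mod_cast h)
      linarith
  exact ⟨S, by linarith, hsol⟩
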